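/- arXiv:1807.03926 — 2 statements merged into one kernel-verified Lean document; each statement's English description precedes it below -/
import Mathlib

section
/- Fix n ≥ 2 and r ≥ 2, place r distinguishable rooks independently and uniformly at random on B_n, and let 𝕏 = (X_α)_{α∈I} be the rook coincidence process: I is the set of pairs ({a,b}, s) with 1 ≤ a < b ≤ r and mark s ∈ {RR, CC, RC, CR}, where X_{({a,b},RR)} = 1{A_a = A_b}, X_{({a,b},CC)} = 1{B_a = B_b}, X_{({a,b},RC)} = 1{B_a = A_b}, and X_{({a,b},CR)} = 1{A_a = B_b}. Let 𝕐 = (Y_α)_{α∈I} be a family of independent Poisson random variables with E Y_α = E X_α for every α ∈ I. Then d_TV(𝕏, 𝕐) ≤ d, where d := r(r−1)(r−3/2) · (362/(9n²)) · ((n(n − 301/181) + 166)/(n−1)²). -/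
open Finset Filter

/-- The triangular board `B_n = {(i,j) : 1 ≤ i < j ≤ n}`. -/
def board (n : ℕ) : Finset (ℕ × ℕ) :=
  (Finset.range (n + 1) ×ˢ Finset.range (n + 1)).filter fun p => 1 ≤ p.1 ∧ p.1 < p.2

/-- Probability of event `E` when `r` distinguishable rooks are placed independently and
uniformly at random on `B_n`; a placement is a function `Fin r → ℕ × ℕ`, rook `a` sitting
on the square `f a = (row, column)`. -/
noncomputable def rookProb (n r : ℕ) (E : (Fin r → ℕ × ℕ) → Prop) : ℝ :=
  ({f : Fin r → ℕ × ℕ | (∀ a, f a ∈ board n) ∧ E f}.ncard : ℝ) / ((board n).card : ℝ) ^ r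

/-- Expectation of an `ℕ`-valued statistic of a uniform random placement of `r` rooks on `B_n`. -/
noncomputable def rookExp (n r : ℕ) (W : (Fin r → ℕ × ℕ) → ℕ) : ℝ :=
  (∑ f ∈ Fintype.piFinset (fun _ : Fin r => board n), (W f : ℝ)) / ((board n).card : ℝ) ^ r

/-- The index set `I` of the rook coincidence process: pairs `{a,b}` of rooks with `a < b`,
together with a mark in `{RR, CC, RC, CR}` (encoded as `Fin 4`, in this order). -/
def RookIndex (r : ℕ) : Type :=
  {p : Fin r × Fin r // p.1 < p.2} × Fin 4

instance (r : ℕ) : Fintype (RookIndex r) := by unfold RookIndex; infer_instance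

/-- The rook coincidence process `𝕏 = (X_α)_{α ∈ I}` as a function of the placement `f`:
`X_{({a,b},RR)} = 1{A_a = A_b}`, `X_{({a,b},CC)} = 1{B_a = B_b}`,
`X_{({a,b},RC)} = 1{B_a = A_b}`, `X_{({a,b},CR)} = 1{A_a = B_b}`,
where `f a = (A_a, B_a)`. -/
def rookProcess (r : ℕ) (f : Fin r → ℕ × ℕ) (α : RookIndex r) : ℕ :=
  let a := α.1.1.1
  let b := α.1.1.2
  if α.2 = 0 then (if (f a).1 = (f b).1 then 1 else 0)
  else if α.2 = 1 then (if (f a).2 = (f b).2 then 1 else 0)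
  else if α.2 = 2 then (if (f a).2 = (f b).1 then 1 else 0)
  else (if (f a).1 = (f b).2 then 1 else 0)

lemma norm_prod_le_one {𝔸 ι : Type*} [NormedCommRing 𝔸] [NormOneClass 𝔸] (s : Finset ι) {a : ι → 𝔸}
    (ha : ∀ i, ‖a i‖ ≤ 1) : ‖∏ i ∈ s, a i‖ ≤ 1 :=
  (Finset.norm_prod_le _ _).trans (Finset.prod_le_one (fun _ _ => norm_nonneg _) fun i _ => ha i)

section CommutativeBanachAlgebra

variable {𝔸 : Type*} [NormedCommRing 𝔸] [NormedAlgebra ℝ 𝔸]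

lemma norm_exp_le_exp_norm [NormOneClass 𝔸] [CompleteSpace 𝔸] (x : 𝔸) :
    ‖NormedSpace.exp x‖ ≤ Real.exp ‖x‖ := by
  rw [NormedSpace.exp_eq_tsum ℝ, Real.exp_eq_exp_ℝ, NormedSpace.exp_eq_tsum ℝ]
  refine (norm_tsum_le_tsum_norm (NormedSpace.norm_expSeries_summable' x)).trans ?_
  refine Summable.tsum_le_tsum (fun k => ?_) (NormedSpace.norm_expSeries_summable' x)
    (NormedSpace.expSeries_summable' (‖x‖ : ℝ))
  rw [norm_smul, smul_eq_mul, Real.norm_of_nonneg (by positivity)]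
  gcongr
  exact norm_pow_le x k

lemma norm_one_add_smul_sub_one_le [NormOneClass 𝔸] {S : 𝔸} (hS : ‖S‖ ≤ 1) {t : ℝ} (ht₀ : 0 ≤ t)
    (ht₁ : t ≤ 1) : ‖1 + t • (S - 1)‖ ≤ 1 := by
  have h : 1 + t • (S - 1) = (1 - t) • (1 : 𝔸) + t • S := by
    rw [smul_sub, sub_smul, one_smul]; abel
  rw [h]
  refine (norm_add_le _ _).trans ?_
  rw [norm_smul, norm_smul, norm_one, Real.norm_of_nonneg ht₀,
    Real.norm_of_nonneg (by linarith : 0 ≤ 1 - t)]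
  nlinarith

lemma norm_exp_smul_sum_smul_sub_one_le [NormOneClass 𝔸] [CompleteSpace 𝔸] {ι : Type*}
    (s : Finset ι) {S : ι → 𝔸} (hS : ∀ i, ‖S i‖ ≤ 1) {l : ι → ℝ} (hl : ∀ i, 0 ≤ l i) {t : ℝ}
    (ht : 0 ≤ t) : ‖NormedSpace.exp (t • ∑ i ∈ s, l i • (S i - 1))‖ ≤ 1 := by
  let +nondep : NormedAlgebra ℚ 𝔸 := .restrictScalars ℚ ℝ 𝔸
  have h : t • ∑ i ∈ s, l i • (S i - 1)
      = algebraMap ℝ 𝔸 (-(t * ∑ i ∈ s, l i)) + t • ∑ i ∈ s, l i • S i := by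
    rw [Algebra.algebraMap_eq_smul_one]
    simp only [smul_sub, sum_sub_distrib, ← sum_smul]
    rw [neg_smul, mul_smul]
    abel
  rw [h, NormedSpace.exp_add, ← NormedSpace.algebraMap_exp_comm, ← Real.exp_eq_exp_ℝ]
  refine (norm_mul_le _ _).trans ?_
  rw [norm_algebraMap', Real.norm_of_nonneg (Real.exp_pos _).le, Real.exp_neg]
  have h₂ : ‖t • ∑ i ∈ s, l i • S i‖ ≤ t * ∑ i ∈ s, l i := by
    rw [norm_smul, Real.norm_of_nonneg ht]
    gcongr
    refine norm_sum_le_of_le _ fun i _ => ?_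
    rw [norm_smul, Real.norm_of_nonneg (hl i)]
    exact mul_le_of_le_one_right (hl i) (hS i)
  have h₃ := (norm_exp_le_exp_norm (t • ∑ i ∈ s, l i • S i)).trans (Real.exp_le_exp.2 h₂)
  rw [inv_mul_le_iff₀ (Real.exp_pos _), mul_one]
  exact h₃

lemma norm_sub_one_mul_prod_sub_prod_le [NormOneClass 𝔸] {ι : Type*} [DecidableEq ι]
    {S : ι → 𝔸} (hS : ∀ i, ‖S i‖ ≤ 1) {t : ℝ} (ht₀ : 0 ≤ t) (ht₁ : t ≤ 1) (i : ι)
    (K : Finset ι) {J : Finset ι} (hKJ : K ⊆ J) :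
    ‖(S i - 1) * (∏ j ∈ J, (1 + t • (S j - 1)) - ∏ j ∈ K, (1 + t • (S j - 1)))‖
      ≤ 4 * t * (J \ K).card := by
  have hD : ∀ j, ‖S j - 1‖ ≤ 2 := fun j =>
    (norm_sub_le _ _).trans (by rw [norm_one]; linarith [hS j])
  have ha := fun j => norm_one_add_smul_sub_one_le (hS j) ht₀ ht₁
  have key : ∀ L : Finset ι, Disjoint K L →
      ‖(S i - 1) * (∏ j ∈ K ∪ L, (1 + t • (S j - 1)) - ∏ j ∈ K, (1 + t • (S j - 1)))‖
        ≤ 4 * t * L.card := by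
    intro L
    induction L using Finset.induction_on with
    | empty => simp
    | insert b L hb ih =>
      intro hd
      rw [disjoint_insert_right] at hd
      have hbKL : b ∉ K ∪ L := by simp [hb, hd.1]
      rw [union_insert, prod_insert hbKL, card_insert_of_notMem hb]
      have e : (S i - 1) * ((1 + t • (S b - 1)) * ∏ j ∈ K ∪ L, (1 + t • (S j - 1))
          - ∏ j ∈ K, (1 + t • (S j - 1)))
          = (S i - 1) * (∏ j ∈ K ∪ L, (1 + t • (S j - 1)) - ∏ j ∈ K, (1 + t • (S j - 1)))
            + t • ((S i - 1) * (S b - 1) * ∏ j ∈ K ∪ L, (1 + t • (S j - 1))) := by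
        simp only [Algebra.smul_def]; ring
      rw [e]
      refine (norm_add_le _ _).trans ?_
      have h₁ : ‖t • ((S i - 1) * (S b - 1) * ∏ j ∈ K ∪ L, (1 + t • (S j - 1)))‖ ≤ t * 4 := by
        rw [norm_smul, Real.norm_of_nonneg ht₀]
        gcongr
        calc _ ≤ ‖S i - 1‖ * ‖S b - 1‖ * ‖∏ j ∈ K ∪ L, (1 + t • (S j - 1))‖ := norm_mul₃_le
          _ ≤ 2 * 2 * 1 := by
            gcongr
            exacts [hD i, hD b, norm_prod_le_one _ ha]
          _ = 4 := by norm_num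
      push_cast
      linarith [ih hd.2]
  have h := key (J \ K) disjoint_sdiff
  rwa [union_sdiff_of_subset hKJ] at h

/-- A Poisson approximation for sums of products of contractions, with local dependence: `J ω` is
the set of indices of the events occurring at `ω`, and `N i` is a dependency neighbourhood
of `i`. -/
theorem norm_sum_smul_prod_sub_exp_le [NormOneClass 𝔸] [CompleteSpace 𝔸] {ι Ω : Type*} [Fintype ι]
    [DecidableEq ι] (s : Finset Ω) (w : Ω → ℝ) (hw : ∀ ω, 0 ≤ w ω) (hw1 : ∑ ω ∈ s, w ω = 1)
    (J : Ω → Finset ι) (N : ι → Finset ι) (hN : ∀ i, i ∈ N i) (l : ι → ℝ)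
    (hl : ∀ i, l i = ∑ ω ∈ s, w ω * if i ∈ J ω then 1 else 0)
    (hind : ∀ i, ∀ ψ : Finset ι → 𝔸,
      ∑ ω ∈ s, w ω • (if i ∈ J ω then ψ (J ω \ N i) else 0)
        = l i • ∑ ω ∈ s, w ω • ψ (J ω \ N i))
    (S : ι → 𝔸) (hS : ∀ i, ‖S i‖ ≤ 1) :
    ‖∑ ω ∈ s, w ω • ∏ i ∈ J ω, S i - NormedSpace.exp (∑ i, l i • (S i - 1))‖
      ≤ 2 * ∑ i, (∑ ω ∈ s, w ω * (if i ∈ J ω then ((J ω ∩ N i).card - 1 : ℝ) else 0)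
        + l i * ∑ ω ∈ s, w ω * (J ω ∩ N i).card) := by
  let +nondep : NormedAlgebra ℚ 𝔸 := .restrictScalars ℚ ℝ 𝔸
  set C := ∑ i, (∑ ω ∈ s, w ω * (if i ∈ J ω then ((J ω ∩ N i).card - 1 : ℝ) else 0)
        + l i * ∑ ω ∈ s, w ω * (J ω ∩ N i).card) with hC
  have hl0 : ∀ i, 0 ≤ l i := fun i => by
    rw [hl]
    exact sum_nonneg fun ω _ => mul_nonneg (hw ω) (by split_ifs <;> norm_num)
  let P : ℝ → Finset ι → 𝔸 := fun t K => ∏ i ∈ K, (1 + t • (S i - 1))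
  let Λ : 𝔸 := ∑ i, l i • (S i - 1)
  let F : ℝ → 𝔸 := fun t => (∑ ω ∈ s, w ω • P t (J ω)) * NormedSpace.exp ((1 - t) • Λ)
  let G : ℝ → 𝔸 := fun t =>
    ∑ i, (S i - 1) * (∑ ω ∈ s, w ω • (if i ∈ J ω then P t (J ω \ {i}) else 0)
      - l i • ∑ ω ∈ s, w ω • P t (J ω))
  have hP : ∀ t K, HasDerivAt (fun t => P t K) (∑ i ∈ K, P t (K \ {i}) * (S i - 1)) t := by
    intro t K
    have := HasDerivAt.fun_finsetProd (u := K) (x := t)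
      (f := fun i (t : ℝ) => 1 + t • (S i - 1)) (f' := fun i => S i - 1) (fun i _ => by
        simpa using ((hasDerivAt_id t).smul_const (S i - 1)).const_add (1 : 𝔸))
    simpa [P, erase_eq, smul_eq_mul] using this
  have hE : ∀ t : ℝ, HasDerivAt (fun t : ℝ => NormedSpace.exp ((1 - t) • Λ))
      (-(Λ * NormedSpace.exp ((1 - t) • Λ))) t := by
    intro t
    have h₁ := hasDerivAt_exp_smul_const' (𝕂 := ℝ) Λ (1 - t)
    have h₂ := h₁.scomp t ((hasDerivAt_id t).const_sub 1)
    simpa [Function.comp_def] using h₂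
  have hF : ∀ t, HasDerivAt F (G t * NormedSpace.exp ((1 - t) • Λ)) t := by
    intro t
    have h : HasDerivAt F ((∑ ω ∈ s, w ω • ∑ i ∈ J ω, P t (J ω \ {i}) * (S i - 1))
        * NormedSpace.exp ((1 - t) • Λ)
        + (∑ ω ∈ s, w ω • P t (J ω)) * -(Λ * NormedSpace.exp ((1 - t) • Λ))) t :=
      (HasDerivAt.fun_sum fun ω _ => (hP t (J ω)).fun_const_smul (w ω)).fun_mul (hE t)
    refine h.congr_deriv ?_
    have e : ∀ D : ι → 𝔸, ∑ i, D i * (∑ ω ∈ s, w ω • (if i ∈ J ω then P t (J ω \ {i}) else 0)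
          - l i • ∑ ω ∈ s, w ω • P t (J ω))
        = ∑ ω ∈ s, w ω • ∑ i ∈ J ω, P t (J ω \ {i}) * D i
          - (∑ i, l i • D i) * ∑ ω ∈ s, w ω • P t (J ω) := by
      intro D
      simp only [mul_sub, sum_sub_distrib, sum_mul, smul_mul_assoc, mul_smul_comm]
      congr 1
      simp only [mul_sum, mul_smul_comm]
      rw [sum_comm]
      refine sum_congr rfl fun ω _ => ?_
      rw [smul_sum, ← sum_filter_add_sum_filter_not univ (· ∈ J ω)]
      simp only [filter_mem_eq_inter, univ_inter]
      rw [sum_congr rfl (g := fun i => w ω • (P t (J ω \ {i}) * D i))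
        fun i hi => by rw [if_pos hi, mul_comm]]
      rw [add_eq_left]
      exact sum_eq_zero fun i hi => by rw [if_neg (mem_filter.1 hi).2]; simp
    rw [show G t = _ from e fun i => S i - 1]
    ring
  have hG : ∀ t, 0 ≤ t → t ≤ 1 → ‖G t‖ ≤ 4 * t * C := by
    intro t ht₀ ht₁
    rw [hC, mul_sum]
    refine norm_sum_le_of_le _ fun i _ => ?_
    have e : ∀ d : 𝔸, d * (∑ ω ∈ s, w ω • (if i ∈ J ω then P t (J ω \ {i}) else 0)
          - l i • ∑ ω ∈ s, w ω • P t (J ω))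
        = ∑ ω ∈ s, w ω • (if i ∈ J ω then d * (P t (J ω \ {i}) - P t (J ω \ N i)) else 0)
          - l i • ∑ ω ∈ s, w ω • (d * (P t (J ω) - P t (J ω \ N i))) := by
      intro d
      have h₁ : ∑ ω ∈ s, w ω • (if i ∈ J ω then d * (P t (J ω \ {i}) - P t (J ω \ N i)) else 0)
          = d * ∑ ω ∈ s, w ω • (if i ∈ J ω then P t (J ω \ {i}) else 0)
            - d * ∑ ω ∈ s, w ω • (if i ∈ J ω then P t (J ω \ N i) else 0) := by
        rw [mul_sum, mul_sum, ← sum_sub_distrib]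
        refine sum_congr rfl fun ω _ => ?_
        split_ifs <;> simp [mul_sub, smul_sub]
      have h₂ : ∑ ω ∈ s, w ω • (d * (P t (J ω) - P t (J ω \ N i)))
          = d * ∑ ω ∈ s, w ω • P t (J ω) - d * ∑ ω ∈ s, w ω • P t (J ω \ N i) := by
        rw [mul_sum, mul_sum, ← sum_sub_distrib]
        exact sum_congr rfl fun ω _ => by simp [mul_sub, smul_sub]
      rw [h₁, h₂, hind i (P t)]
      simp only [mul_sub, smul_sub, mul_smul_comm]
      abel
    rw [e, mul_add]
    refine (norm_sub_le _ _).trans (add_le_add ?_ ?_)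
    · rw [mul_sum]
      refine norm_sum_le_of_le _ fun ω _ => ?_
      rw [norm_smul, Real.norm_of_nonneg (hw ω), mul_left_comm]
      refine mul_le_mul_of_nonneg_left ?_ (hw ω)
      split_ifs with h
      · refine (norm_sub_one_mul_prod_sub_prod_le hS ht₀ ht₁ i _
          (sdiff_subset_sdiff le_rfl (singleton_subset_iff.2 (hN i)))).trans_eq ?_
        have hset : (J ω \ {i}) \ (J ω \ N i) = (J ω ∩ N i).erase i := by
          ext j; simp; tauto
        rw [hset, card_erase_of_mem (mem_inter.2 ⟨h, hN i⟩), Nat.cast_pred]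
        exact card_pos.2 ⟨i, mem_inter.2 ⟨h, hN i⟩⟩
      · simp
    · rw [norm_smul, Real.norm_of_nonneg (hl0 i), mul_left_comm]
      refine mul_le_mul_of_nonneg_left ?_ (hl0 i)
      rw [mul_sum]
      refine norm_sum_le_of_le _ fun ω _ => ?_
      rw [norm_smul, Real.norm_of_nonneg (hw ω), mul_left_comm]
      refine mul_le_mul_of_nonneg_left ?_ (hw ω)
      refine (norm_sub_one_mul_prod_sub_prod_le hS ht₀ ht₁ i _ sdiff_subset).trans_eq ?_
      rw [sdiff_sdiff_right_self, inf_eq_inter]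
  have hB : ∀ x : ℝ, HasDerivAt (fun t => 2 * C * t ^ 2) (4 * x * C) x := by
    intro x
    refine ((hasDerivAt_pow 2 x).const_mul (2 * C)).congr_deriv ?_
    norm_num
    ring
  have hfin := image_norm_le_of_norm_deriv_right_le_deriv_boundary (a := 0) (b := 1)
    (f := fun t => F t - F 0) (f' := fun t => G t * NormedSpace.exp ((1 - t) • Λ))
    (fun x _ => ((hF x).sub_const _).continuousAt.continuousWithinAt)
    (fun x _ => ((hF x).sub_const _).hasDerivWithinAt) (B := fun t => 2 * C * t ^ 2)
    (by simp) hB (fun x hx => by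
      refine (norm_mul_le _ _).trans ?_
      refine (mul_le_of_le_one_right (norm_nonneg _) ?_).trans (hG x hx.1 hx.2.le)
      exact norm_exp_smul_sum_smul_sub_one_le _ hS hl0 (by linarith [hx.2]))
    (Set.right_mem_Icc.2 zero_le_one)
  simpa [F, P, Λ, ← sum_smul, hw1] using hfin

end CommutativeBanachAlgebra

lemma hasSum_mul_prod {R κ γ : Type*} [NormedRing R] [CompleteSpace R] {F : κ → R} {G : γ → R}
    {b : R} (hF : Summable fun k => ‖F k‖) (hG : Summable fun k => ‖G k‖) (hb : HasSum G b) :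
    HasSum (fun p : κ × γ => F p.1 * G p.2) ((∑' k, F k) * b) :=
  hF.of_norm.hasSum.mul hb (summable_mul_of_summable_norm hF hG)

lemma hasSum_pi_prod_fin {R κ : Type*} [NormedCommRing R] [CompleteSpace R]
    (n : ℕ) (f : Fin n → κ → R) (hf : ∀ i, Summable fun k => ‖f i k‖) :
    (Summable fun g : Fin n → κ => ‖∏ i, f i (g i)‖) ∧
      HasSum (fun g : Fin n → κ => ∏ i, f i (g i)) (∏ i, ∑' k, f i k) := by
  induction n with
  | zero => exact ⟨(hasSum_unique _).summable, by simp [hasSum_unique]⟩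
  | succ n ih =>
    obtain ⟨h₁, h₂⟩ := ih (fun i => f i.succ) fun i => hf _
    have e : ∀ p : κ × (Fin n → κ), ∏ i, f i (Fin.consEquiv (fun _ => κ) p i)
        = f 0 p.1 * ∏ i : Fin n, f i.succ (p.2 i) := fun p => by
      rw [Fin.prod_univ_succ]
      rfl
    constructor
    · rw [← (Fin.consEquiv fun _ => κ).summable_iff]
      refine ((hf 0).mul_norm h₁).congr fun p => ?_
      rw [Function.comp_apply, e]
    · rw [← (Fin.consEquiv fun _ => κ).hasSum_iff, Fin.prod_univ_succ]
      refine (hasSum_mul_prod (hf 0) h₁ h₂).congr_fun fun p => ?_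
      rw [Function.comp_apply, e]

lemma hasSum_pi_prod {ι R κ : Type*} [Fintype ι] [NormedCommRing R]
    [CompleteSpace R] (f : ι → κ → R) (hf : ∀ i, Summable fun k => ‖f i k‖) :
    HasSum (fun g : ι → κ => ∏ i, f i (g i)) (∏ i, ∑' k, f i k) := by
  let e := Fintype.equivFin ι
  have h := (hasSum_pi_prod_fin _ (fun i => f (e.symm i)) fun i => hf _).2
  rw [← (e.arrowCongr (Equiv.refl κ)).hasSum_iff] at h
  rw [← e.symm.prod_comp]
  convert! h using 2 with g
  rw [← e.symm.prod_comp]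
  simp

universe u in
/-- A commuting family in a Banach algebra lives in a commutative Banach algebra. -/
lemma exists_isometry_commutative {R : Type u} [NormedRing R] [NormOneClass R] [NormedAlgebra ℝ R]
    [CompleteSpace R] {ι : Type*} (S : ι → R) (hS : ∀ i j, S i * S j = S j * S i) :
    ∃ (𝔸 : Type u) (_ : NormedCommRing 𝔸) (_ : NormedAlgebra ℝ 𝔸) (_ : NormOneClass 𝔸)
      (_ : CompleteSpace 𝔸) (φ : 𝔸 →ₐ[ℝ] R) (T : ι → 𝔸),
      (∀ a, ‖φ a‖ = ‖a‖) ∧ ∀ i, φ (T i) = S i := by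
  let A := (Algebra.adjoin ℝ (Set.range S)).topologicalClosure
  have hcomm : ∀ x y : A, x * y = y * x := by
    refine (Subalgebra.commRingTopologicalClosure (Algebra.adjoin ℝ (Set.range S))
        fun x y => Subtype.ext ?_).mul_comm
    refine Algebra.commute_of_mem_adjoin_of_forall_mem_commute y.2 fun a ha => ?_
    refine (Algebra.commute_of_mem_adjoin_of_forall_mem_commute x.2 fun b hb => ?_).symm
    obtain ⟨i, rfl⟩ := ha
    obtain ⟨j, rfl⟩ := hb
    exact hS i j
  let instA : NormedCommRing A := { (inferInstance : NormedRing A) with mul_comm := hcomm }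
  let instB : NormedAlgebra ℝ A :=
    { (inferInstance : Algebra ℝ A) with
      norm_smul_le := fun a x => norm_smul_le a (x : R) }
  refine ⟨A, instA, instB, ⟨norm_one (α := R)⟩,
    (Subalgebra.isClosed_topologicalClosure _).completeSpace_coe, A.val,
    fun i => ⟨S i, Subalgebra.le_topologicalClosure _ (Algebra.subset_adjoin ⟨i, rfl⟩)⟩,
    fun a => rfl, fun i => rfl⟩

/-- The operator shifting the argument of a bounded function by one in the coordinate `i`. -/
noncomputable def shift {ι : Type*} [DecidableEq ι] [Finite ι] (i : ι) :
    BoundedContinuousFunction (ι → ℕ) ℝ →L[ℝ] BoundedContinuousFunction (ι → ℕ) ℝ :=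
  BoundedContinuousFunction.compContinuousCLM ℝ ℝ ⟨fun x => x + Pi.single i 1, by fun_prop⟩

lemma shift_apply {ι : Type*} [DecidableEq ι] [Finite ι] (i : ι)
    (f : BoundedContinuousFunction (ι → ℕ) ℝ) (x : ι → ℕ) :
    shift i f x = f (x + Pi.single i 1) := rfl

lemma norm_shift_le {ι : Type*} [DecidableEq ι] [Finite ι] (i : ι) : ‖shift i‖ ≤ 1 :=
  ContinuousLinearMap.opNorm_le_bound _ zero_le_one fun f => by
    rw [one_mul]
    exact f.norm_compContinuous_le _

open ProbabilityTheory in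
lemma hasSum_poissonPMFReal_smul_pow {𝔸 : Type*} [NormedCommRing 𝔸] [NormedAlgebra ℝ 𝔸]
    [CompleteSpace 𝔸] {ι : Type*} [Fintype ι] {l : ι → ℝ} (hl : ∀ i, 0 ≤ l i) (T : ι → 𝔸) :
    HasSum (fun g : ι → ℕ => (∏ i, poissonPMFReal (Real.toNNReal (l i)) (g i)) • ∏ i, T i ^ g i)
      (NormedSpace.exp (∑ i, l i • (T i - 1))) := by
  let +nondep : NormedAlgebra ℚ 𝔸 := .restrictScalars ℚ ℝ 𝔸
  have e : ∀ i k, poissonPMFReal (Real.toNNReal (l i)) k • T i ^ k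
      = Real.exp (-l i) • ((k.factorial : ℝ)⁻¹ • (l i • T i) ^ k) := by
    intro i k
    rw [poissonPMFReal, Real.coe_toNNReal _ (hl i), smul_pow, smul_smul, smul_smul]
    congr 1
    field_simp
  have hs : ∀ i, Summable fun k => ‖poissonPMFReal (Real.toNNReal (l i)) k • T i ^ k‖ := by
    intro i
    simp only [e, norm_smul (Real.exp (-l i))]
    exact (NormedSpace.norm_expSeries_summable' (𝕂 := ℝ) (l i • T i)).mul_left _
  have h := hasSum_pi_prod (fun i k => poissonPMFReal (Real.toNNReal (l i)) k • T i ^ k) hs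
  simp only [Finset.prod_smul] at h
  rw [NormedSpace.exp_sum]
  convert! h using 2 with i
  simp only [e]
  rw [((NormedSpace.exp_series_hasSum_exp' (𝕂 := ℝ) (l i • T i)).const_smul _).tsum_eq,
    smul_sub, sub_eq_neg_add, ← neg_smul, ← Algebra.algebraMap_eq_smul_one, NormedSpace.exp_add,
    ← NormedSpace.algebraMap_exp_comm, ← Real.exp_eq_exp_ℝ,
    ← Algebra.smul_def]

lemma shift_pow_apply {ι : Type*} [DecidableEq ι] [Finite ι] (i : ι) (k : ℕ)
    (f : BoundedContinuousFunction (ι → ℕ) ℝ) (x : ι → ℕ) :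
    (shift i ^ k) f x = f (x + Pi.single i k) := by
  induction k generalizing x with
  | zero => simp
  | succ k ih =>
    rw [pow_succ', mul_apply_eq_comp, shift_apply, ih, add_assoc, ← Pi.single_add,
      add_comm 1 k]

lemma map_prod_pow_apply_of_map_eq_shift {ι : Type*} [DecidableEq ι] [Finite ι] {𝔸 : Type*}
    [CommRing 𝔸] [Algebra ℝ 𝔸]
    (φ : 𝔸 →ₐ[ℝ] (BoundedContinuousFunction (ι → ℕ) ℝ →L[ℝ] BoundedContinuousFunction (ι → ℕ) ℝ))
    {T : ι → 𝔸} (hT : ∀ i, φ (T i) = shift i) (k : ι → ℕ) (s : Finset ι)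
    (f : BoundedContinuousFunction (ι → ℕ) ℝ) (x : ι → ℕ) :
    φ (∏ i ∈ s, T i ^ k i) f x = f (x + ∑ i ∈ s, Pi.single i (k i)) := by
  induction s using Finset.induction_on generalizing x with
  | empty => simp
  | insert b s hb ih =>
    rw [prod_insert hb, sum_insert hb, map_mul, map_pow, hT, mul_apply_eq_comp,
      shift_pow_apply, ih, add_assoc]

open ProbabilityTheory in
/-- Local-dependence Poisson approximation in total variation for the process of indicators of
finitely many events. -/
theorem abs_sum_indicator_sub_tsum_poisson_le {ι Ω : Type*} [Fintype ι] [DecidableEq ι]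
    (s : Finset Ω) (w : Ω → ℝ) (hw : ∀ ω, 0 ≤ w ω) (hw1 : ∑ ω ∈ s, w ω = 1)
    (J : Ω → Finset ι) (N : ι → Finset ι) (hN : ∀ i, i ∈ N i) (l : ι → ℝ)
    (hl : ∀ i, l i = ∑ ω ∈ s, w ω * if i ∈ J ω then 1 else 0)
    (hind : ∀ i K, ∑ ω ∈ s, w ω * (if i ∈ J ω ∧ J ω \ N i = K then 1 else 0)
        = l i * ∑ ω ∈ s, w ω * (if J ω \ N i = K then 1 else 0))
    (A : Set (ι → ℕ)) :
    |∑ ω ∈ s, w ω * A.indicator 1 (fun i => if i ∈ J ω then 1 else 0)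
      - ∑' g : ι → ℕ,
        A.indicator (fun g => ∏ i, poissonPMFReal (Real.toNNReal (l i)) (g i)) g|
      ≤ ∑ i, (∑ ω ∈ s, w ω * (if i ∈ J ω then ((J ω ∩ N i).card - 1 : ℝ) else 0)
        + l i * ∑ ω ∈ s, w ω * (J ω ∩ N i).card) := by
  have : Nontrivial (BoundedContinuousFunction (ι → ℕ) ℝ) :=
    ⟨0, 1, fun h => zero_ne_one (congrArg (fun f => f 0) h)⟩
  obtain ⟨𝔸, _, _, _, _, φ, T, hφ, hT⟩ := exists_isometry_commutative
    (shift (ι := ι)) fun i j => ContinuousLinearMap.ext fun f =>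
      BoundedContinuousFunction.ext fun x => by simp [shift_apply, add_right_comm]
  have hl0 : ∀ i, 0 ≤ l i := fun i => by
    rw [hl]
    exact sum_nonneg fun ω _ => mul_nonneg (hw ω) (by split_ifs <;> norm_num)
  have hT1 : ∀ i, ‖T i‖ ≤ 1 := fun i => by
    rw [← hφ, hT]
    exact norm_shift_le i
  have hvec : ∀ i, ∀ ψ : Finset ι → 𝔸, ∑ ω ∈ s, w ω • (if i ∈ J ω then ψ (J ω \ N i) else 0)
        = l i • ∑ ω ∈ s, w ω • ψ (J ω \ N i) := by
    intro i ψ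
    have h₁ : ∀ ω, w ω • (if i ∈ J ω then ψ (J ω \ N i) else 0)
        = ∑ K, (w ω * (if i ∈ J ω ∧ J ω \ N i = K then 1 else 0)) • ψ K := by
      intro ω
      rw [sum_eq_single (J ω \ N i)]
      · by_cases h : i ∈ J ω <;> simp [h]
      · intro K _ hK
        simp [hK.symm]
      · simp
    have h₂ : ∀ ω, w ω • ψ (J ω \ N i)
        = ∑ K, (w ω * (if J ω \ N i = K then 1 else 0)) • ψ K := by
      intro ω
      rw [sum_eq_single (J ω \ N i)]
      · simp
      · intro K _ hK
        simp [hK.symm]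
      · simp
    simp only [h₁, h₂]
    rw [sum_comm, sum_comm (s := s), smul_sum]
    refine sum_congr rfl fun K _ => ?_
    rw [← sum_smul, ← sum_smul, hind, mul_smul]
  have hmain := norm_sum_smul_prod_sub_exp_le s w hw hw1 J N hN l hl hvec T hT1
  have hbd : ∀ x, ‖A.indicator (1 : (ι → ℕ) → ℝ) x - 1 / 2‖ ≤ 1 / 2 := by
    intro x
    by_cases h : x ∈ A <;> norm_num [h]
  let f : BoundedContinuousFunction (ι → ℕ) ℝ := .ofNormedAddCommGroupDiscrete _ (1 / 2) hbd
  have hf : ‖f‖ ≤ 1 / 2 := BoundedContinuousFunction.norm_le (by norm_num) |>.2 hbd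
  let ev : 𝔸 →L[ℝ] ℝ := LinearMap.mkContinuous
    { toFun := fun a => φ a f 0
      map_add' := by simp
      map_smul' := by simp } (1 / 2) fun a => by
        refine ((φ a f).norm_coe_le_norm 0).trans (((φ a).le_opNorm f).trans ?_)
        rw [hφ, mul_comm]
        gcongr
  have hev : ∀ a, ‖ev a‖ ≤ 1 / 2 * ‖a‖ := fun a =>
    ev.le_of_opNorm_le (LinearMap.mkContinuous_norm_le _ (by norm_num) _) a
  have hevT : ∀ (k : ι → ℕ), ev (∏ i, T i ^ k i) = A.indicator 1 k - 1 / 2 := by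
    intro k
    refine (map_prod_pow_apply_of_map_eq_shift φ hT k univ f 0).trans ?_
    rw [zero_add, univ_sum_single]
    rfl
  have hevJ : ∀ ω, ev (∏ i ∈ J ω, T i)
      = A.indicator 1 (fun i => if i ∈ J ω then 1 else 0) - 1 / 2 := by
    intro ω
    rw [← hevT]
    congr 1
    simp only [pow_ite, pow_one, pow_zero, prod_ite_mem, univ_inter]
  have hsum : HasSum (fun g : ι → ℕ =>
      A.indicator (fun g => ∏ i, poissonPMFReal (Real.toNNReal (l i)) (g i)) g)
      (ev (NormedSpace.exp (∑ i, l i • (T i - 1))) + 1 / 2) := by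
    have h₁ := ev.hasSum (hasSum_poissonPMFReal_smul_pow hl0 T)
    have h₂ := (hasSum_poissonPMFReal_smul_pow hl0 (fun _ : ι => (1 : ℝ))).mul_right (1 / 2)
    have h₃ := h₁.add h₂
    simp only [sub_self, smul_zero, sum_const_zero, NormedSpace.exp_zero, one_mul, one_pow,
      prod_const_one] at h₃
    refine h₃.congr_fun fun g => ?_
    simp only [map_smul, hevT, smul_eq_mul]
    by_cases h : g ∈ A <;> simp [h]; ring
  have hX : ev (∑ ω ∈ s, w ω • ∏ i ∈ J ω, T i)
      = ∑ ω ∈ s, w ω * A.indicator 1 (fun i => if i ∈ J ω then 1 else 0) - 1 / 2 := by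
    simp only [map_sum, map_smul, hevJ, smul_eq_mul, mul_sub, sum_sub_distrib, ← sum_mul, hw1,
      one_mul]
  have h := (hev _).trans (mul_le_mul_of_nonneg_left hmain (by norm_num : (0 : ℝ) ≤ 1 / 2))
  rw [map_sub, hX, ← mul_assoc, one_div, inv_mul_cancel₀ two_ne_zero, one_mul, ← one_div] at h
  rw [hsum.tsum_eq, ← Real.norm_eq_abs]
  refine le_of_eq_of_le ?_ h
  rw [sub_sub, add_comm (1 / 2 : ℝ)]

section Resampling

variable {κ β : Type*} [Fintype κ] [DecidableEq κ]

lemma sum_piFinset_eq_of_update (B : Finset β) (b : κ) (φ ψ : (κ → β) → ℝ) (c : ℝ)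
    (h : ∀ f ∈ Fintype.piFinset fun _ : κ => B, ∑ y ∈ B, φ (Function.update f b y) = c * ψ f) :
    B.card * ∑ f ∈ Fintype.piFinset (fun _ : κ => B), φ f
      = c * ∑ f ∈ Fintype.piFinset (fun _ : κ => B), ψ f := by
  rw [mul_sum _ ψ, ← sum_congr rfl h, ← sum_product', mul_sum]
  simp only [← nsmul_eq_mul, ← sum_const]
  rw [← sum_product']
  have hmem : ∀ p ∈ Fintype.piFinset (fun _ : κ => B) ×ˢ B,
      (Function.update p.1 b p.2, p.1 b) ∈ Fintype.piFinset (fun _ : κ => B) ×ˢ B := by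
    simp only [mem_product, Fintype.mem_piFinset]
    rintro p ⟨hp, hy⟩
    refine ⟨fun a => ?_, hp b⟩
    rcases eq_or_ne a b with rfl | hab
    · simpa using hy
    · simpa [hab] using hp a
  exact sum_nbij' (fun p => (Function.update p.1 b p.2, p.1 b))
    (fun p => (Function.update p.1 b p.2, p.1 b)) hmem hmem (by simp) (by simp) (by simp)

lemma sum_piFinset_mul_of_dependsOn (B : Finset β) (S : Finset κ) (φ ψ : (κ → β) → ℝ)
    (hφ : ∀ f g, (∀ a ∈ S, f a = g a) → φ f = φ g)
    (hψ : ∀ f g, (∀ a ∉ S, f a = g a) → ψ f = ψ g) :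
    (B.card : ℝ) ^ Fintype.card κ * ∑ f ∈ Fintype.piFinset (fun _ : κ => B), φ f * ψ f
      = (∑ f ∈ Fintype.piFinset (fun _ : κ => B), φ f)
        * ∑ f ∈ Fintype.piFinset (fun _ : κ => B), ψ f := by
  have hc : (B.card : ℝ) ^ Fintype.card κ = (Fintype.piFinset (fun _ : κ => B)).card := by
    simp
  rw [hc, sum_mul_sum, ← sum_product', mul_comm, sum_mul]
  simp only [mul_comm _ ((Fintype.piFinset (fun _ : κ => B)).card : ℝ)]
  simp only [← nsmul_eq_mul, ← sum_const]
  rw [← sum_product']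
  have hmem : ∀ p ∈ Fintype.piFinset (fun _ : κ => B) ×ˢ Fintype.piFinset (fun _ : κ => B),
      (S.piecewise p.1 p.2, S.piecewise p.2 p.1)
        ∈ Fintype.piFinset (fun _ : κ => B) ×ˢ Fintype.piFinset (fun _ : κ => B) := by
    simp only [mem_product, Fintype.mem_piFinset]
    rintro p ⟨hp, hq⟩
    exact ⟨fun a => by by_cases h : a ∈ S <;> simp [h, hp a, hq a],
      fun a => by by_cases h : a ∈ S <;> simp [h, hp a, hq a]⟩
  refine sum_nbij' (fun p => (S.piecewise p.1 p.2, S.piecewise p.2 p.1))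
    (fun p => (S.piecewise p.1 p.2, S.piecewise p.2 p.1)) hmem hmem ?_ ?_ ?_
  · intro p _
    ext a <;> by_cases h : a ∈ S <;> simp [h]
  · intro p _
    ext a <;> by_cases h : a ∈ S <;> simp [h]
  · intro p _
    congr 1
    · exact hφ _ _ fun a ha => by simp [ha]
    · exact hψ _ _ fun a ha => by simp [ha]

end Resampling

/-- The value of the mark `m` at a pair of squares. -/
def markValue (m : Fin 4) (x y : ℕ × ℕ) : ℕ :=
  if m = 0 then (if x.1 = y.1 then 1 else 0)
  else if m = 1 then (if x.2 = y.2 then 1 else 0)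
  else if m = 2 then (if x.2 = y.1 then 1 else 0)
  else (if x.1 = y.2 then 1 else 0)

/-- The number of coincidences between two squares. -/
def coincidences (x y : ℕ × ℕ) : ℕ := ∑ m, markValue m x y

lemma coincidences_eq (x y : ℕ × ℕ) : coincidences x y =
    (if x.1 = y.1 then 1 else 0) + (if x.2 = y.2 then 1 else 0) + (if x.2 = y.1 then 1 else 0)
      + if x.1 = y.2 then 1 else 0 := by
  simp [coincidences, markValue, Fin.sum_univ_four]

lemma coincidences_comm (x y : ℕ × ℕ) : coincidences x y = coincidences y x := by
  simp only [coincidences_eq, eq_comm (a := x.1), eq_comm (a := x.2)]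
  ring

lemma mem_board {n : ℕ} {x : ℕ × ℕ} : x ∈ board n ↔ 1 ≤ x.1 ∧ x.1 < x.2 ∧ x.2 ≤ n := by
  simp only [board, mem_filter, mem_product, mem_range]
  omega

lemma coincidences_sq {n : ℕ} {x y : ℕ × ℕ} (hx : x ∈ board n) (hy : y ∈ board n) :
    coincidences x y * coincidences x y = coincidences x y + 2 * if y = x then 1 else 0 := by
  rw [mem_board] at hx hy
  simp only [coincidences_eq, Prod.ext_iff]
  split_ifs <;> omega

lemma sum_board_eq_add_eq {n i : ℕ} (h₁ : 1 ≤ i) (h₂ : i ≤ n) :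
    ∑ y ∈ board n, ((if i = y.1 then 1 else 0) + if i = y.2 then 1 else 0) = n - 1 := by
  rw [sum_add_distrib, ← card_filter, ← card_filter]
  have e₁ : (board n).filter (fun y => i = y.1) = {i} ×ˢ Ioc i n := by
    ext y
    simp only [mem_filter, mem_board, mem_product, mem_singleton, mem_Ioc]
    omega
  have e₂ : (board n).filter (fun y => i = y.2) = Ico 1 i ×ˢ {i} := by
    ext y
    simp only [mem_filter, mem_board, mem_product, mem_singleton, mem_Ico]
    omega
  rw [e₁, e₂, card_product, card_product]
  simp
  omega

lemma sum_board_coincidences {n : ℕ} {x : ℕ × ℕ} (hx : x ∈ board n) :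
    ∑ y ∈ board n, coincidences x y = 2 * (n - 1) := by
  rw [mem_board] at hx
  rw [two_mul]
  nth_rw 1 [← sum_board_eq_add_eq (n := n) (i := x.1) (by omega) (by omega)]
  rw [← sum_board_eq_add_eq (n := n) (i := x.2) (by omega) (by omega), ← sum_add_distrib]
  refine sum_congr rfl fun y _ => ?_
  rw [coincidences_eq]
  ring

lemma two_mul_card_board (n : ℕ) : 2 * (board n).card = n * (n - 1) := by
  have h : ∑ i ∈ Icc 1 n, ∑ y ∈ board n, ((if i = y.1 then 1 else 0) + if i = y.2 then 1 else 0)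
      = ∑ i ∈ Icc 1 n, (n - 1) :=
    sum_congr rfl fun i hi => sum_board_eq_add_eq (mem_Icc.1 hi).1 (mem_Icc.1 hi).2
  rw [sum_comm, sum_const, Nat.card_Icc, add_tsub_cancel_right, smul_eq_mul] at h
  rw [← h, mul_comm, ← smul_eq_mul, ← sum_const]
  refine sum_congr rfl fun y hy => ?_
  rw [mem_board] at hy
  rw [sum_add_distrib, sum_ite_eq', sum_ite_eq', if_pos (by simp; omega), if_pos (by simp; omega)]

lemma cast_card_board {n : ℕ} (hn : 2 ≤ n) : ((board n).card : ℝ) = n * (n - 1) / 2 := by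
  have h : ((2 * (board n).card : ℕ) : ℝ) = (n * (n - 1) : ℕ) := by rw [two_mul_card_board]
  push_cast [Nat.cast_sub (by omega : 1 ≤ n)] at h
  linarith

section Moments

variable {n r : ℕ}

lemma card_board_mul_sum_mul_coincidences (hn : 2 ≤ n) (φ : (Fin r → ℕ × ℕ) → ℝ) {c d : Fin r}
    (hcd : c ≠ d) (hφ : ∀ f y, φ (Function.update f d y) = φ f) :
    ((board n).card : ℝ) * ∑ f ∈ Fintype.piFinset (fun _ : Fin r => board n),
        φ f * coincidences (f c) (f d)
      = 2 * (n - 1) * ∑ f ∈ Fintype.piFinset (fun _ : Fin r => board n), φ f := by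
  refine sum_piFinset_eq_of_update _ d _ _ _ fun f hf => ?_
  simp only [hφ, Function.update_self, Function.update_of_ne hcd, ← mul_sum]
  rw [← Nat.cast_sum, sum_board_coincidences (Fintype.mem_piFinset.1 hf c)]
  push_cast [Nat.cast_sub (by omega : 1 ≤ n)]
  ring

/-- The average of `φ` over all placements of `r` rooks. -/
noncomputable def rookMean (n r : ℕ) (φ : (Fin r → ℕ × ℕ) → ℝ) : ℝ :=
  ∑ f ∈ Fintype.piFinset (fun _ : Fin r => board n), (((board n).card : ℝ) ^ r)⁻¹ * φ f

lemma rookMean_one (hn : 2 ≤ n) : rookMean n r (fun _ => 1) = 1 := by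
  have : ((board n).card : ℝ) ≠ 0 := by
    rw [cast_card_board hn]
    have : (2 : ℝ) ≤ n := by exact_mod_cast hn
    have : (0 : ℝ) < n * (n - 1) / 2 := by apply div_pos (mul_pos _ _) <;> linarith
    exact this.ne'
  simp [rookMean, this]

lemma rookMean_mul_coincidences (hn : 2 ≤ n) (φ : (Fin r → ℕ × ℕ) → ℝ) {c d : Fin r}
    (hcd : c ≠ d) (hφ : ∀ f y, φ (Function.update f d y) = φ f) :
    rookMean n r (fun f => φ f * coincidences (f c) (f d)) = 4 / n * rookMean n r φ := by
  have h := card_board_mul_sum_mul_coincidences hn φ hcd hφ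
  have hn' : (2 : ℝ) ≤ n := by exact_mod_cast hn
  simp only [rookMean, ← mul_sum]
  rw [mul_left_comm]
  congr 1
  rw [cast_card_board hn] at h
  rw [div_mul_eq_mul_div, eq_div_iff (by positivity)]
  have : (n : ℝ) - 1 ≠ 0 := by linarith
  refine mul_left_cancel₀ this ?_
  linear_combination 2 * h

lemma rookMean_mul_coincidences_swap (hn : 2 ≤ n) (φ : (Fin r → ℕ × ℕ) → ℝ) {c d : Fin r}
    (hcd : c ≠ d) (hφ : ∀ f y, φ (Function.update f c y) = φ f) :
    rookMean n r (fun f => φ f * coincidences (f c) (f d)) = 4 / n * rookMean n r φ := by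
  rw [← rookMean_mul_coincidences hn φ hcd.symm hφ]
  simp only [coincidences_comm]

lemma rookMean_coincidences (hn : 2 ≤ n) {c d : Fin r} (hcd : c ≠ d) :
    rookMean n r (fun f => coincidences (f c) (f d)) = 4 / n := by
  have h := rookMean_mul_coincidences hn (fun _ => 1) hcd fun _ _ => rfl
  simpa [rookMean_one hn] using h

lemma rookMean_coincidences_mul_self (hn : 2 ≤ n) {c d : Fin r} (hcd : c ≠ d) :
    rookMean n r (fun f => (coincidences (f c) (f d) : ℝ) * coincidences (f c) (f d))
      = 4 / n + 4 / (n * (n - 1)) := by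
  have h := sum_piFinset_eq_of_update (board n) d
    (fun f => (coincidences (f c) (f d) : ℝ) * coincidences (f c) (f d)) (fun _ => 1)
    (2 * n) fun f hf => by
      have hc := Fintype.mem_piFinset.1 hf c
      simp only [Function.update_self, Function.update_of_ne hcd]
      have e := sum_congr rfl fun y hy => coincidences_sq hc (n := n) (y := y) hy
      rw [sum_add_distrib, sum_board_coincidences hc, ← mul_sum, sum_ite_eq', if_pos hc] at e
      have e' := congrArg (Nat.cast (R := ℝ)) e
      push_cast [Nat.cast_sub (by omega : 1 ≤ n)] at e'
      rw [e']
      ring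
  have h1 := rookMean_one (r := r) hn
  have hn' : (2 : ℝ) ≤ n := by exact_mod_cast hn
  have hn1 : (n : ℝ) - 1 ≠ 0 := by linarith
  simp only [rookMean, ← mul_sum] at h1 ⊢
  have h2 := congrArg (fun x => (((board n).card : ℝ) ^ r)⁻¹ * x) h
  simp only [mul_left_comm _ (2 * (n : ℝ)), h1, mul_left_comm _ ((board n).card : ℝ)] at h2
  generalize (((board n).card : ℝ) ^ r)⁻¹ *
    ∑ f ∈ Fintype.piFinset (fun _ : Fin r => board n),
      (coincidences (f c) (f d) : ℝ) * coincidences (f c) (f d) = z at h2 ⊢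
  rw [cast_card_board hn] at h2
  have hn0 : (n : ℝ) ≠ 0 := by positivity
  have hz : z * (n - 1) = 4 := mul_left_cancel₀ hn0 (by linear_combination 2 * h2)
  have e : (4 : ℝ) / n + 4 / (n * (n - 1)) = 4 / (n - 1) := by
    field_simp
    ring
  rw [e, eq_div_iff hn1, hz]

lemma rookMean_coincidences_mul (hn : 2 ≤ n) {a b c d : Fin r} (hab : a < b) (hcd : c < d)
    (h : (a, b) ≠ (c, d)) :
    rookMean n r (fun f => (coincidences (f a) (f b) : ℝ) * coincidences (f c) (f d))
      = 16 / n ^ 2 := by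
  have e : (16 : ℝ) / n ^ 2 = 4 / n * (4 / n) := by ring
  rw [e]
  by_cases hd : d = a ∨ d = b
  · have hc : c ≠ a ∧ c ≠ b := by
      rw [Ne, Prod.mk.injEq] at h
      omega
    rw [rookMean_mul_coincidences_swap hn _ hcd.ne, rookMean_coincidences hn hab.ne]
    intro f y
    rw [Function.update_of_ne hc.1.symm, Function.update_of_ne hc.2.symm]
  · push Not at hd
    rw [rookMean_mul_coincidences hn _ hcd.ne, rookMean_coincidences hn hab.ne]
    intro f y
    rw [Function.update_of_ne hd.1.symm, Function.update_of_ne hd.2.symm]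

end Moments

section Pairs

variable {r : ℕ}

/-- The pairs that share an element with `e`. -/
def meetingPairs (e : {p : Fin r × Fin r // p.1 < p.2}) :
    Finset {p : Fin r × Fin r // p.1 < p.2} :=
  univ.filter fun e' => e'.1.1 = e.1.1 ∨ e'.1.1 = e.1.2 ∨ e'.1.2 = e.1.1 ∨ e'.1.2 = e.1.2

lemma self_mem_meetingPairs (e : {p : Fin r × Fin r // p.1 < p.2}) : e ∈ meetingPairs e := by
  simp [meetingPairs]

lemma card_meetingPairs_le (e : {p : Fin r × Fin r // p.1 < p.2}) :
    (meetingPairs e).card + 3 ≤ 2 * r := by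
  obtain ⟨⟨a, b⟩, hab⟩ := e
  have hab' : a < b := hab
  have hsub : (meetingPairs ⟨(a, b), hab⟩).image Subtype.val
      ⊆ (univ.erase a).image (fun c => (min a c, max a c))
        ∪ ((univ.erase a).erase b).image (fun c => (min b c, max b c)) := by
    rintro ⟨c, d⟩ h
    simp only [meetingPairs, mem_image, mem_filter, mem_univ, true_and, Subtype.exists,
      Prod.exists, mem_union, mem_erase, Prod.mk.injEq, and_true] at h ⊢
    obtain ⟨c', d', hcd, h, rfl, rfl⟩ := h
    have hcd' : c' < d' := hcd
    by_cases h₁ : c' = a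
    · exact .inl ⟨d', by omega, by subst h₁; simp [hcd'.le]⟩
    by_cases h₂ : d' = a
    · exact .inl ⟨c', h₁, by subst h₂; simp [hcd'.le]⟩
    rcases (by omega : c' = b ∨ d' = b) with rfl | rfl
    · exact .inr ⟨d', ⟨by omega, h₂⟩, by simp [hcd'.le]⟩
    · exact .inr ⟨c', ⟨by omega, h₁⟩, by simp [hcd'.le]⟩
  have h := card_le_card hsub
  rw [card_image_of_injective _ Subtype.val_injective] at h
  have h' := h.trans ((card_union_le _ _).trans (add_le_add card_image_le card_image_le))
  rw [card_erase_of_mem (mem_erase.2 ⟨hab'.ne', mem_univ _⟩), card_erase_of_mem (mem_univ _),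
    card_univ, Fintype.card_fin] at h'
  have := a.2
  have := b.2
  have : (a : ℕ) < b := hab'
  omega

lemma two_mul_card_pairs_le :
    2 * Fintype.card {p : Fin r × Fin r // p.1 < p.2} ≤ r * (r - 1) := by
  have h : (univ.filter fun p : Fin r × Fin r => p.1 < p.2).disjUnion
      ((univ.filter fun p : Fin r × Fin r => p.1 < p.2).map (Equiv.prodComm _ _).toEmbedding)
      (by
        rw [disjoint_left]
        rintro ⟨a, b⟩
        simp
        omega)
      ⊆ (univ : Finset (Fin r)).offDiag := by
    intro p hp
    simp only [mem_disjUnion, mem_filter, mem_univ, true_and, mem_map_equiv, mem_offDiag,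
      Equiv.prodComm_symm, Equiv.prodComm_apply, Prod.fst_swap, Prod.snd_swap] at hp ⊢
    omega
  have h' := card_le_card h
  rw [card_disjUnion, card_map, offDiag_card, card_univ, Fintype.card_fin, ← two_mul] at h'
  rwa [Fintype.card_subtype, Nat.mul_sub, mul_one]

end Pairs

section CoincidenceProcess

variable {n r : ℕ}

/-- The pair of rooks of an index. -/
def RookIndex.pair (α : RookIndex r) : {p : Fin r × Fin r // p.1 < p.2} := α.1

/-- The mark of an index. -/
def RookIndex.mark (α : RookIndex r) : Fin 4 := α.2

/-- The index with a given pair and mark. -/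
def RookIndex.ofPair (e : {p : Fin r × Fin r // p.1 < p.2}) (m : Fin 4) : RookIndex r := (e, m)

lemma RookIndex.pair_ofPair (e : {p : Fin r × Fin r // p.1 < p.2}) (m : Fin 4) :
    (RookIndex.ofPair e m).pair = e := rfl

lemma rookProcess_eq_markValue (f : Fin r → ℕ × ℕ) (α : RookIndex r) :
    rookProcess r f α = markValue α.mark (f α.pair.1.1) (f α.pair.1.2) := rfl

lemma rookProcess_eq_ite (f : Fin r → ℕ × ℕ) (α : RookIndex r) :
    rookProcess r f α = if rookProcess r f α = 1 then 1 else 0 := by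
  simp only [rookProcess_eq_markValue, markValue]
  split_ifs <;> simp_all

lemma sum_rookIndex (F : RookIndex r → ℝ) :
    ∑ α, F α = ∑ e : {p : Fin r × Fin r // p.1 < p.2}, ∑ m : Fin 4, F (.ofPair e m) := by
  rw [← Fintype.sum_prod_type']
  exact Fintype.sum_equiv (Equiv.refl _) _ _ fun _ => rfl

/-- The indices of the coincidences occurring in the placement `f`. -/
def occurring (f : Fin r → ℕ × ℕ) : Finset (RookIndex r) :=
  univ.filter fun α => rookProcess r f α = 1

lemma mem_occurring {f : Fin r → ℕ × ℕ} {α : RookIndex r} :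
    α ∈ occurring f ↔ rookProcess r f α = 1 := by
  simp [occurring]

/-- The indices whose pair of rooks meets that of `α`. -/
def meetingIndices (α : RookIndex r) : Finset (RookIndex r) :=
  univ.filter fun β => β.pair ∈ meetingPairs α.pair

/-- The number of coincidences between the two rooks in the pair `e`. -/
def pairCoincidences (f : Fin r → ℕ × ℕ) (e : {p : Fin r × Fin r // p.1 < p.2}) : ℝ :=
  coincidences (f e.1.1) (f e.1.2)

lemma sum_rookProcess (f : Fin r → ℕ × ℕ) (e : {p : Fin r × Fin r // p.1 < p.2}) :
    ∑ m : Fin 4, (rookProcess r f (.ofPair e m) : ℝ) = pairCoincidences f e := by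
  rw [pairCoincidences, coincidences, Nat.cast_sum]
  rfl

lemma card_occurring_inter_meetingIndices [DecidableEq (RookIndex r)] (f : Fin r → ℕ × ℕ)
    (α : RookIndex r) : ((occurring f ∩ meetingIndices α).card : ℝ)
      = ∑ e ∈ meetingPairs α.pair, pairCoincidences f e := by
  have e : occurring f ∩ meetingIndices α
      = univ.filter fun β : RookIndex r => β.pair ∈ meetingPairs α.pair ∧ rookProcess r f β = 1 := by
    ext β
    simp [occurring, meetingIndices, and_comm]
  rw [e, card_filter, Nat.cast_sum, sum_rookIndex, ← sum_filter_add_sum_filter_not univ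
    (fun e => e ∈ meetingPairs α.pair), add_eq_left.2, filter_mem_eq_inter, univ_inter]
  · refine sum_congr rfl fun e he => ?_
    rw [← sum_rookProcess]
    refine sum_congr rfl fun m _ => ?_
    rw [rookProcess_eq_ite]
    simp [he, RookIndex.pair_ofPair]
  · refine sum_eq_zero fun e he => sum_eq_zero fun m _ => ?_
    simp [(mem_filter.1 he).2, RookIndex.pair_ofPair]

lemma rookMean_sub (φ ψ : (Fin r → ℕ × ℕ) → ℝ) :
    rookMean n r (fun f => φ f - ψ f) = rookMean n r φ - rookMean n r ψ := by
  simp [rookMean, mul_sub, sum_sub_distrib]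

lemma rookMean_sum {ι : Type*} (s : Finset ι) (φ : ι → (Fin r → ℕ × ℕ) → ℝ) :
    rookMean n r (fun f => ∑ i ∈ s, φ i f) = ∑ i ∈ s, rookMean n r (φ i) := by
  simp only [rookMean, mul_sum]
  exact sum_comm

lemma rookMean_mul_of_dependsOn (hn : 2 ≤ n) (S : Finset (Fin r)) (φ ψ : (Fin r → ℕ × ℕ) → ℝ)
    (hφ : ∀ f g, (∀ a ∈ S, f a = g a) → φ f = φ g)
    (hψ : ∀ f g, (∀ a ∉ S, f a = g a) → ψ f = ψ g) :
    rookMean n r (fun f => φ f * ψ f) = rookMean n r φ * rookMean n r ψ := by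
  have h := sum_piFinset_mul_of_dependsOn (board n) S φ ψ hφ hψ
  have h0 : ((board n).card : ℝ) ^ r ≠ 0 := by
    intro h
    simpa [rookMean, h] using rookMean_one (r := r) hn
  rw [Fintype.card_fin] at h
  simp only [rookMean, ← mul_sum]
  rw [mul_mul_mul_comm, ← h]
  field_simp

lemma rookExp_eq_rookMean (W : (Fin r → ℕ × ℕ) → ℕ) :
    rookExp n r W = rookMean n r fun f => W f := by
  rw [rookExp, rookMean, ← mul_sum, div_eq_inv_mul]

lemma rookProb_eq_rookMean (E : (Fin r → ℕ × ℕ) → Prop) [DecidablePred E] :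
    rookProb n r E = rookMean n r fun f => if E f then 1 else 0 := by
  have e : {f : Fin r → ℕ × ℕ | (∀ a, f a ∈ board n) ∧ E f}
      = ((Fintype.piFinset fun _ : Fin r => board n).filter E : Finset (Fin r → ℕ × ℕ)) := by
    ext f
    simp
  rw [rookProb, rookMean, ← mul_sum, div_eq_inv_mul, e, Set.ncard_coe_finset, sum_boole]

lemma rookMean_occurring_sdiff [DecidableEq (RookIndex r)] (hn : 2 ≤ n) (α : RookIndex r)
    (K : Finset (RookIndex r)) :
    rookMean n r (fun f =>
        if α ∈ occurring f ∧ occurring f \ meetingIndices α = K then 1 else 0)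
      = rookMean n r (fun f => if α ∈ occurring f then 1 else 0)
        * rookMean n r (fun f => if occurring f \ meetingIndices α = K then 1 else 0) := by
  rw [← rookMean_mul_of_dependsOn hn {α.pair.1.1, α.pair.1.2}]
  · congr 1
    ext f
    split_ifs <;> simp_all
  · intro f g h
    have : α ∈ occurring f ↔ α ∈ occurring g := by
      rw [mem_occurring, mem_occurring, rookProcess_eq_markValue, rookProcess_eq_markValue]
      rw [h α.pair.1.1 (by simp), h α.pair.1.2 (by simp)]
    simp only [this]
  · intro f g h
    have : occurring f \ meetingIndices α = occurring g \ meetingIndices α := by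
      ext β
      simp only [meetingIndices, meetingPairs, Finset.mem_sdiff, mem_filter, mem_univ, true_and,
        mem_occurring, rookProcess_eq_markValue]
      refine and_congr_left fun hβ => ?_
      push Not at hβ
      rw [h β.pair.1.1 (by simp [hβ]), h β.pair.1.2 (by simp [hβ])]
    rw [this]

lemma rookMean_pairCoincidences_mul_le (hn : 2 ≤ n)
    (e : {p : Fin r × Fin r // p.1 < p.2}) :
    rookMean n r (fun f =>
        pairCoincidences f e * (∑ e' ∈ meetingPairs e, pairCoincidences f e' - 1))
      + rookMean n r (fun f => pairCoincidences f e)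
        * rookMean n r (fun f => ∑ e' ∈ meetingPairs e, pairCoincidences f e')
      ≤ 4 / (n * (n - 1)) + (4 * r - 7) * (16 / n ^ 2) := by
  have h₁ : ∀ e : {p : Fin r × Fin r // p.1 < p.2},
      rookMean n r (fun f => pairCoincidences f e) = 4 / n :=
    fun e => rookMean_coincidences hn e.2.ne
  have h₂ : ∀ e' ∈ (meetingPairs e).erase e,
      rookMean n r (fun f => pairCoincidences f e * pairCoincidences f e') = 16 / n ^ 2 :=
    fun e' he' => rookMean_coincidences_mul hn e.2 e'.2
      fun h => (mem_erase.1 he').1 (Subtype.ext h.symm)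
  have h₃ : rookMean n r (fun f => pairCoincidences f e * pairCoincidences f e)
      = 4 / n + 4 / (n * (n - 1)) := rookMean_coincidences_mul_self hn e.2.ne
  have hc := card_meetingPairs_le e
  have hpos := card_pos.2 ⟨e, self_mem_meetingPairs e⟩
  have hc' : ((meetingPairs e).card : ℝ) + 3 ≤ 2 * r := by exact_mod_cast hc
  have h₀ : rookMean n r (fun f =>
        pairCoincidences f e * (∑ e' ∈ meetingPairs e, pairCoincidences f e' - 1))
      = ∑ e' ∈ meetingPairs e, rookMean n r (fun f => pairCoincidences f e * pairCoincidences f e')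
        - rookMean n r (fun f => pairCoincidences f e) := by
    simp only [mul_sub, mul_sum, mul_one, rookMean_sub, rookMean_sum]
  rw [h₀, rookMean_sum, ← add_sum_erase _ _ (self_mem_meetingPairs e), h₃, sum_congr rfl h₂]
  simp only [h₁, sum_const, nsmul_eq_mul, card_erase_of_mem (self_mem_meetingPairs e)]
  rw [Nat.cast_sub hpos]
  have h16 : (0 : ℝ) ≤ 16 / n ^ 2 := by positivity
  have h4 : (4 / n : ℝ) * (4 / n) = 16 / n ^ 2 := by ring
  rw [mul_left_comm, h4]
  push_cast
  linarith [mul_le_mul_of_nonneg_right hc' h16]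

lemma sum_dependence_eq [DecidableEq (RookIndex r)] :
    ∑ α : RookIndex r, (rookMean n r (fun f =>
          if α ∈ occurring f then ((occurring f ∩ meetingIndices α).card - 1 : ℝ) else 0)
        + rookExp n r (fun f => rookProcess r f α)
          * rookMean n r (fun f => (occurring f ∩ meetingIndices α).card))
      = ∑ e : {p : Fin r × Fin r // p.1 < p.2}, (rookMean n r (fun f =>
          pairCoincidences f e * (∑ e' ∈ meetingPairs e, pairCoincidences f e' - 1))
        + rookMean n r (fun f => pairCoincidences f e)
          * rookMean n r (fun f => ∑ e' ∈ meetingPairs e, pairCoincidences f e')) := by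
  rw [sum_rookIndex]
  refine sum_congr rfl fun e _ => ?_
  simp only [card_occurring_inter_meetingIndices, RookIndex.pair_ofPair]
  rw [sum_add_distrib, ← sum_mul, ← rookMean_sum]
  simp only [rookExp_eq_rookMean]
  rw [← rookMean_sum]
  simp only [← sum_rookProcess _ e, sum_mul]
  congr 2
  ext f
  refine sum_congr rfl fun m _ => ?_
  rw [rookProcess_eq_ite]
  simp [occurring]

lemma rook_bound_le (hn : 2 ≤ n) (hr : 2 ≤ r) :
    Fintype.card {p : Fin r × Fin r // p.1 < p.2}
        * ((4 : ℝ) / (n * (n - 1)) + (4 * r - 7) * (16 / n ^ 2))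
      ≤ (r : ℝ) * ((r : ℝ) - 1) * ((r : ℝ) - 3/2) * (362 / (9 * (n : ℝ) ^ 2)) *
          (((n : ℝ) * ((n : ℝ) - 301/181) + 166) / ((n : ℝ) - 1) ^ 2) := by
  have hc : (2 : ℝ) * Fintype.card {p : Fin r × Fin r // p.1 < p.2} ≤ r * (r - 1) := by
    have h : ((2 * Fintype.card {p : Fin r × Fin r // p.1 < p.2} : ℕ) : ℝ)
      ≤ (r * (r - 1) : ℕ) := Nat.cast_le.2 two_mul_card_pairs_le
    push_cast [Nat.cast_sub (by omega : 1 ≤ r)] at h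
    exact h
  have hn' : (2 : ℝ) ≤ n := by exact_mod_cast hn
  have hr' : (2 : ℝ) ≤ r := by exact_mod_cast hr
  have h₁ : (4 : ℝ) / (n * (n - 1)) ≤ 8 / n ^ 2 := by
    rw [div_le_div_iff₀ (mul_pos (by linarith) (by linarith)) (by positivity)]
    nlinarith
  have h₂ : (1 : ℝ) ≤ ((n : ℝ) * ((n : ℝ) - 301/181) + 166) / ((n : ℝ) - 1) ^ 2 := by
    rw [one_le_div (pow_pos (by linarith) 2)]
    nlinarith
  have hrr : (0 : ℝ) ≤ r * (r - 1) := mul_nonneg (by linarith) (by linarith)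
  have h₃ : (0 : ℝ) ≤ (r : ℝ) * ((r : ℝ) - 1) * ((r : ℝ) - 3/2) * (362 / (9 * (n : ℝ) ^ 2)) :=
    mul_nonneg (mul_nonneg hrr (by linarith)) (by positivity)
  calc _ ≤ (r * (r - 1) / 2 : ℝ) * ((64 * r - 104) * (1 / n ^ 2)) := by
        refine mul_le_mul (by linarith) ?_ ?_ (by linarith)
        · calc _ ≤ (8 : ℝ) / n ^ 2 + (4 * r - 7) * (16 / n ^ 2) := by linarith
            _ = _ := by ring
        · have : (0 : ℝ) < n * (n - 1) := mul_pos (by linarith) (by linarith)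
          have : (0 : ℝ) ≤ (4 * r - 7) * (16 / n ^ 2) := mul_nonneg (by linarith) (by positivity)
          positivity
    _ = (r * (r - 1)) * (32 * r - 52) * (1 / n ^ 2) := by ring
    _ ≤ (r * (r - 1)) * ((r - 3 / 2) * (362 / 9)) * (1 / n ^ 2) := by
        gcongr
        linarith
    _ = (r : ℝ) * ((r : ℝ) - 1) * ((r : ℝ) - 3/2) * (362 / (9 * (n : ℝ) ^ 2)) := by
        field_simp
    _ ≤ _ := le_mul_of_one_le_right h₃ h₂

end CoincidenceProcess

/-- for `n ≥ 2`, `r ≥ 2`, and `r` rooks placed independently and uniformly at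
random on `B_n`, the total variation distance between the law of the rook coincidence process
`𝕏 = (X_α)_{α ∈ I}` and the law of a family `𝕐 = (Y_α)_{α ∈ I}` of independent Poisson random
variables with `E Y_α = E X_α` is at most
`d = r(r−1)(r−3/2)·(362/(9n²))·((n(n−301/181)+166)/(n−1)²)`. -/
theorem rook_process_poisson_approx (n r : ℕ) (hn : 2 ≤ n) (hr : 2 ≤ r) :
    (⨆ A : Set (RookIndex r → ℕ),
      |rookProb n r (fun f => rookProcess r f ∈ A) -
        ∑' g : RookIndex r → ℕ,
          A.indicator
            (fun g => ∏ α : RookIndex r,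
              ProbabilityTheory.poissonPMFReal
                (Real.toNNReal (rookExp n r (fun f => rookProcess r f α))) (g α)) g|)
      ≤ (r : ℝ) * ((r : ℝ) - 1) * ((r : ℝ) - 3/2) * (362 / (9 * (n : ℝ) ^ 2)) *
          (((n : ℝ) * ((n : ℝ) - 301/181) + 166) / ((n : ℝ) - 1) ^ 2) := by
  classical
  have hl : ∀ α : RookIndex r, rookExp n r (fun f => rookProcess r f α)
      = rookMean n r (fun f => if α ∈ occurring f then 1 else 0) := fun α => by
    rw [rookExp_eq_rookMean]
    congr 1
    ext f
    rw [rookProcess_eq_ite]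
    simp [occurring]
  refine ciSup_le fun A => ?_
  have hA : rookProb n r (fun f => rookProcess r f ∈ A)
      = rookMean n r fun f => A.indicator 1 (fun α => if α ∈ occurring f then 1 else 0) := by
    rw [rookProb_eq_rookMean]
    congr 1
    ext f
    have : rookProcess r f = fun α => if α ∈ occurring f then 1 else 0 := by
      ext α
      rw [rookProcess_eq_ite]
      simp [occurring]
    rw [this, Set.indicator_apply]
    rfl
  rw [hA]
  refine (abs_sum_indicator_sub_tsum_poisson_le
    (Fintype.piFinset fun _ : Fin r => board n) (fun _ => (((board n).card : ℝ) ^ r)⁻¹)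
    (fun _ => by positivity) (by simpa [rookMean] using rookMean_one (r := r) hn)
    occurring meetingIndices (fun α => by simp [meetingIndices, self_mem_meetingPairs]) _ hl
    (fun α K => by rw [hl]; exact rookMean_occurring_sdiff hn α K) A).trans ?_
  refine sum_dependence_eq.trans_le ?_
  refine (sum_le_sum fun e _ => rookMean_pairCoincidences_mul_le hn e).trans ?_
  rw [sum_const, nsmul_eq_mul, card_univ]
  exact rook_bound_le hn hr
end

section
/- Let t > 0 and let (k(n)) be an increasing sequence of positive integers with (n − k(n))/√n → t as n → ∞. For each n write k = k(n) and r = n − k, let D = (D_1, D_2, ...) be the block-size counts of a uniformly random set partition of {1,...,n} into exactly k blocks, and let Z_2 be a Poisson random variable with mean (2/3)·r²/n. Then there exist a constant C > 0 and N such that for all n ≥ N, d_TV( D , (2k − n + Z_2, r − 2Z_2, Z_2, 0, 0, ...) ) ≤ C · exp((4/3)·r²/n) · r³/n²; in particular the total variation distance is O(exp((4/3)(n−k)²/n) · (n−k)³/n²). -/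
open Finset Filter

/-- Probability of event `E` for a uniformly random set partition of `{1,…,n}` into exactly
`k` blocks (a `Finpartition` of `Finset.univ : Finset (Fin n)` with `k` parts). -/
noncomputable def partProb (n k : ℕ)
    (E : Finpartition (Finset.univ : Finset (Fin n)) → Prop) : ℝ :=
  (Nat.card {P : Finpartition (Finset.univ : Finset (Fin n)) //
      P.parts.card = k ∧ E P} : ℝ) /
    (Nat.card {P : Finpartition (Finset.univ : Finset (Fin n)) // P.parts.card = k} : ℝ)

/-- `D_i`, the number of blocks of size `i` in a set partition. -/
def blockCount {n : ℕ} (P : Finpartition (Finset.univ : Finset (Fin n))) (i : ℕ) : ℕ :=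
  (P.parts.filter fun b => b.card = i).card

section Surj
variable {α β : Type*} [Fintype α] [Fintype β] [DecidableEq α] [DecidableEq β]

/-- The number of elements that `f` sends to `j`. -/
def fiberCard (f : α → β) (j : β) : ℕ := #{x | f x = j}

omit [Fintype β] in
theorem fiberCard_update_same {f : α → β} {x : α} {i : β} (h : i ≠ f x) :
    fiberCard (Function.update f x i) i = fiberCard f i + 1 := by
  have : ({y | Function.update f x i y = i} : Finset α) =
      insert x ({y | f y = i} : Finset α) := by
    ext y
    by_cases hy : y = x <;> simp [hy]
  rw [fiberCard, this, card_insert_of_notMem (by simpa using h.symm), fiberCard]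

omit [Fintype β] in
theorem fiberCard_update_source {f : α → β} {x : α} {i : β} (h : i ≠ f x) :
    fiberCard (Function.update f x i) (f x) + 1 = fiberCard f (f x) := by
  have : ({y | f y = f x} : Finset α) =
      insert x ({y | Function.update f x i y = f x} : Finset α) := by
    ext y
    by_cases hy : y = x <;> simp [hy]
  rw [fiberCard, fiberCard, this, card_insert_of_notMem (by simpa using h)]

omit [Fintype β] in
theorem fiberCard_update_of_ne {f : α → β} {x : α} {i j : β} (h : j ≠ f x) (hi : j ≠ i) :
    fiberCard (Function.update f x i) j = fiberCard f j := by
  unfold fiberCard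
  congr 1
  ext y
  by_cases hy : y = x
  · simp [hy, h.symm, hi.symm]
  · simp [hy]

omit [Fintype β] [DecidableEq α] in
theorem surjective_iff_fiberCard_pos {f : α → β} :
    Function.Surjective f ↔ ∀ j, 1 ≤ fiberCard f j := by
  simp [Function.Surjective, fiberCard, Nat.one_le_iff_ne_zero, filter_eq_empty_iff]

omit [DecidableEq α] in
theorem sum_fiberCard (f : α → β) : ∑ j, fiberCard f j = Fintype.card α := by
  simpa [fiberCard] using (card_eq_sum_card_fiberwise (s := univ) (t := univ) (f := f)
    (by simp)).symm

omit [DecidableEq α] in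
theorem card_filter_fiberCard (f : α → β) (p : ℕ → Prop) [DecidablePred p] :
    #{x | p (fiberCard f (f x))} = ∑ j with p (fiberCard f j), fiberCard f j := by
  rw [card_eq_sum_card_fiberwise (t := {j | p (fiberCard f j)}) (f := f)]
  · refine sum_congr rfl fun j hj => ?_
    simp only [mem_filter, mem_univ, true_and] at hj
    unfold fiberCard
    congr 1
    ext x
    simp only [mem_filter, mem_univ, true_and, and_iff_right_iff_imp]
    rintro rfl
    exact hj
  · intro x hx
    simpa using hx

omit [Fintype α] [Fintype β] [DecidableEq β] in
/-- Moving an element to another fibre is reversible, so a set of moves whose reversed moves all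
satisfy given constraints is at most as large as the set of moves satisfying them. -/
theorem sum_moves_le (F G : Finset (α → β)) (X Y : (α → β) → Finset α)
    (I J : (α → β) → α → Finset β)
    (h : ∀ f ∈ F, ∀ x ∈ X f, ∀ i ∈ I f x, Function.update f x i ∈ G ∧
      x ∈ Y (Function.update f x i) ∧ f x ∈ J (Function.update f x i) x) :
    ∑ f ∈ F, ∑ x ∈ X f, #(I f x) ≤ ∑ g ∈ G, ∑ y ∈ Y g, #(J g y) := by
  have hl : ∑ f ∈ F, ∑ x ∈ X f, #(I f x) = #(F.sigma fun f => (X f).sigma fun x => I f x) := by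
    simp only [card_sigma]
  have hr : ∑ f ∈ G, ∑ x ∈ Y f, #(J f x) = #(G.sigma fun f => (Y f).sigma fun x => J f x) := by
    simp only [card_sigma]
  rw [hl, hr]
  let Φ : (Σ _ : α → β, Σ _ : α, β) → (Σ _ : α → β, Σ _ : α, β) := fun m =>
    ⟨Function.update m.1 m.2.1 m.2.2, m.2.1, m.1 m.2.1⟩
  have hΦ : Function.Involutive Φ := by
    rintro ⟨f, x, i⟩
    simp [Φ]
  refine card_le_card_of_injOn Φ ?_ hΦ.injective.injOn
  rintro ⟨f, x, i⟩ hm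
  simp only [coe_sigma, Set.mem_sigma_iff, mem_coe] at hm
  simpa [Φ] using h f hm.1 x hm.2.1 i hm.2.2

omit [DecidableEq α] in
theorem card_add_card_big_le {f : α → β} (hf : Function.Surjective f) :
    Fintype.card β + #{j | 2 ≤ fiberCard f j} ≤ Fintype.card α := by
  rw [← sum_fiberCard f, card_filter, ← card_univ, card_eq_sum_ones, ← sum_add_distrib]
  refine sum_le_sum fun j _ => ?_
  have := surjective_iff_fiberCard_pos.1 hf j
  split_ifs <;> omega

omit [DecidableEq α] in
theorem card_eq_card_single_add {f : α → β} (hf : Function.Surjective f) :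
    Fintype.card β = #{j | fiberCard f j = 1} + #{j | 2 ≤ fiberCard f j} := by
  rw [card_filter, card_filter, ← card_univ, card_eq_sum_ones, ← sum_add_distrib]
  refine sum_congr rfl fun j _ => ?_
  have := surjective_iff_fiberCard_pos.1 hf j
  split_ifs <;> omega

variable (α β) in
/-- The surjections from `α` to `β`. -/
noncomputable def surjections : Finset (α → β) := by
  classical exact {f | Function.Surjective f}

@[simp] theorem mem_surjections {f : α → β} :
    f ∈ surjections α β ↔ Function.Surjective f := by simp [surjections]

/-- Moving an element from a fibre of size at least `m + 1` to a fibre of size one. -/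
theorem sum_card_big_le {r m : ℕ} (hr : Fintype.card β + r = Fintype.card α) (hm : 2 ≤ m) :
    (m + 1) * (Fintype.card β - r) * ∑ f ∈ surjections α β, #{j | m + 1 ≤ fiberCard f j} ≤
      2 * r * ∑ f ∈ surjections α β, #{j | m ≤ fiberCard f j} := by
  have key := sum_moves_le (surjections α β) (surjections α β)
    (fun f => {x | m + 1 ≤ fiberCard f (f x)}) (fun f => {x | fiberCard f (f x) = 2})
    (fun f _ => {j | fiberCard f j = 1}) (fun f _ => {j | m ≤ fiberCard f j}) ?_
  · simp only [sum_const, smul_eq_mul] at key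
    calc _ = ∑ f ∈ surjections α β,
          (m + 1) * (Fintype.card β - r) * #{j | m + 1 ≤ fiberCard f j} := by rw [mul_sum]
      _ ≤ _ := sum_le_sum fun f hf => ?_
      _ ≤ _ := key
      _ ≤ ∑ f ∈ surjections α β, 2 * r * #{j | m ≤ fiberCard f j} := sum_le_sum fun f hf => ?_
      _ = _ := by rw [mul_sum]
    · rw [mem_surjections] at hf
      have h1 := card_eq_card_single_add hf
      have h2 := card_add_card_big_le hf
      have h3 : (m + 1) * #{j | m + 1 ≤ fiberCard f j} ≤ #{x | m + 1 ≤ fiberCard f (f x)} := by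
        rw [card_filter_fiberCard f (fun c => m + 1 ≤ c), mul_comm, ← smul_eq_mul]
        exact card_nsmul_le_sum _ _ _ fun j hj => by simpa using hj
      calc _ = ((m + 1) * #{j | m + 1 ≤ fiberCard f j}) * (Fintype.card β - r) := by ring
        _ ≤ _ := Nat.mul_le_mul h3 (by omega)
    · rw [mem_surjections] at hf
      have h2 := card_add_card_big_le hf
      gcongr
      rw [card_filter_fiberCard f (fun c => c = 2)]
      calc _ = ∑ j with fiberCard f j = 2, 2 :=
            sum_congr rfl fun j hj => by simpa using hj
        _ = 2 * #{j | fiberCard f j = 2} := by simp [mul_comm]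
        _ ≤ 2 * #{j | 2 ≤ fiberCard f j} := by
            gcongr 2 * ?_
            exact card_le_card (monotone_filter_right univ fun j _ (h : fiberCard f j = 2) => h.ge)
        _ ≤ _ := by omega
  · intro f hf x hx i hi
    simp only [mem_filter, mem_univ, true_and, mem_surjections,
      surjective_iff_fiberCard_pos] at hf hx hi ⊢
    have hne : i ≠ f x := by rintro rfl; omega
    have h1 := fiberCard_update_same hne
    have h2 := fiberCard_update_source hne
    refine ⟨fun j => ?_, by simp only [Function.update_self]; omega, by omega⟩
    by_cases hj : j = i
    · subst hj; omega
    by_cases hj' : j = f x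
    · subst hj'; omega
    rw [fiberCard_update_of_ne hj' hj]
    exact hf j

variable (α β) in
/-- The surjections from `α` to `β` with all fibres of size at most three and exactly `z` fibres
of size three. -/
noncomputable def tripleSurjections (z : ℕ) : Finset (α → β) :=
  {f ∈ surjections α β | (∀ j, fiberCard f j ≤ 3) ∧ #{j | fiberCard f j = 3} = z}

theorem card_double_single_of_mem {f : α → β} {z r : ℕ}
    (hr : Fintype.card β + r = Fintype.card α) (hf : f ∈ tripleSurjections α β z) :
    #{j | fiberCard f j = 2} + 2 * z = r ∧ #{j | fiberCard f j = 1} + r = Fintype.card β + z := by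
  simp only [tripleSurjections, mem_filter, mem_surjections, surjective_iff_fiberCard_pos] at hf
  obtain ⟨h1, h3, hz⟩ := hf
  have hn : #{j | fiberCard f j = 1} + 2 * #{j | fiberCard f j = 2} + 3 * z = Fintype.card α := by
    rw [← sum_fiberCard f, ← hz, card_filter, card_filter, card_filter, mul_sum, mul_sum,
      ← sum_add_distrib, ← sum_add_distrib]
    refine sum_congr rfl fun j _ => ?_
    have := h1 j
    have := h3 j
    split_ifs <;> omega
  have hk : #{j | fiberCard f j = 1} + #{j | fiberCard f j = 2} + z = Fintype.card β := by
    rw [← hz, ← card_univ (α := β), card_eq_sum_ones univ, card_filter, card_filter, card_filter,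
      ← sum_add_distrib, ← sum_add_distrib]
    refine sum_congr rfl fun j _ => ?_
    have := h1 j
    have := h3 j
    split_ifs <;> omega
  omega

/-- Two fibres of size two correspond to a fibre of size three together with one of size one. -/
theorem card_tripleSurjections_succ {r : ℕ} (hr : Fintype.card β + r = Fintype.card α)
    (hk : r ≤ Fintype.card β) (z : ℕ) :
    #(tripleSurjections α β (z + 1)) * (3 * (z + 1) * (Fintype.card β - r + z + 1)) =
      #(tripleSurjections α β z) * (2 * (r - 2 * z) * (r - 2 * z - 1)) := by
  have hl : #(tripleSurjections α β (z + 1)) * (3 * (z + 1) * (Fintype.card β - r + z + 1)) =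
      ∑ f ∈ tripleSurjections α β (z + 1),
        ∑ x with fiberCard f (f x) = 3, #{j | fiberCard f j = 1} := by
    rw [← smul_eq_mul, ← sum_const]
    refine sum_congr rfl fun f hf => ?_
    obtain ⟨-, h⟩ := card_double_single_of_mem hr hf
    rw [sum_const, smul_eq_mul, card_filter_fiberCard f (fun c => c = 3),
      sum_congr rfl (g := fun _ => 3) fun j hj => by simpa using hj]
    have : #{j | fiberCard f j = 3} = z + 1 := by
      simp only [tripleSurjections, mem_filter] at hf
      exact hf.2.2
    rw [sum_const, this, smul_eq_mul, mul_comm 3]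
    congr 1
    omega
  have hrr : #(tripleSurjections α β z) * (2 * (r - 2 * z) * (r - 2 * z - 1)) =
      ∑ f ∈ tripleSurjections α β z,
        ∑ x with fiberCard f (f x) = 2, #(({j | fiberCard f j = 2} : Finset β).erase (f x)) := by
    rw [← smul_eq_mul, ← sum_const]
    refine sum_congr rfl fun f hf => ?_
    obtain ⟨h, -⟩ := card_double_single_of_mem hr hf
    have h' : #{j | fiberCard f j = 2} = r - 2 * z := by omega
    rw [sum_congr rfl (g := fun _ => r - 2 * z - 1) fun x hx => by
        rw [card_erase_of_mem (by simpa using hx), h'],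
      sum_const, smul_eq_mul, card_filter_fiberCard f (fun c => c = 2),
      sum_congr rfl (g := fun _ => 2) fun j hj => by simpa using hj,
      sum_const, h', smul_eq_mul, mul_comm 2]
  rw [hl, hrr]
  apply le_antisymm
  · refine sum_moves_le _ _ _ _ _ _ fun f hf x hx i hi => ?_
    simp only [tripleSurjections, mem_filter, mem_univ, true_and, mem_surjections, mem_erase,
      surjective_iff_fiberCard_pos, Function.update_self] at hf hx hi ⊢
    have hne : i ≠ f x := by rintro rfl; omega
    have h1 := fiberCard_update_same hne
    have h2 := fiberCard_update_source hne
    have hc (j : β) : fiberCard (Function.update f x i) j =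
        if j = i then 2 else if j = f x then 2 else fiberCard f j := by
      split_ifs with h h'
      · rw [h]; omega
      · rw [h']; omega
      · exact fiberCard_update_of_ne h' h
    refine ⟨⟨fun j => ?_, fun j => ?_, ?_⟩, by omega, hne.symm, by omega⟩
    · have := hf.1 j
      rw [hc]; split_ifs <;> omega
    · have := hf.2.1 j
      rw [hc]; split_ifs <;> omega
    · have : ({j | fiberCard (Function.update f x i) j = 3} : Finset β) =
          ({j | fiberCard f j = 3} : Finset β).erase (f x) := by
        ext j
        simp only [mem_filter, mem_univ, true_and, mem_erase, hc]
        split_ifs with h h' <;> simp [*]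
      rw [this, card_erase_of_mem (by simpa using hx), hf.2.2, Nat.add_sub_cancel]
  · refine sum_moves_le _ _ _ _ _ _ fun f hf x hx i hi => ?_
    simp only [tripleSurjections, mem_filter, mem_univ, true_and, mem_surjections, mem_erase,
      surjective_iff_fiberCard_pos, Function.update_self] at hf hx hi ⊢
    obtain ⟨hne, hi⟩ := hi
    have h1 := fiberCard_update_same hne
    have h2 := fiberCard_update_source hne
    have hc (j : β) : fiberCard (Function.update f x i) j =
        if j = i then 3 else if j = f x then 1 else fiberCard f j := by
      split_ifs with h h'
      · rw [h]; omega
      · rw [h']; omega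
      · exact fiberCard_update_of_ne h' h
    refine ⟨⟨fun j => ?_, fun j => ?_, ?_⟩, by omega, by omega⟩
    · have := hf.1 j
      rw [hc]; split_ifs <;> omega
    · have := hf.2.1 j
      rw [hc]; split_ifs <;> omega
    · have : ({j | fiberCard (Function.update f x i) j = 3} : Finset β) =
          insert i ({j | fiberCard f j = 3} : Finset β) := by
        ext j
        simp only [mem_filter, mem_univ, true_and, mem_insert, hc]
        split_ifs with h h'
        · simp [h]
        · simp [h', hx, hne.symm]
        · simp [h]
      rw [this, card_insert_of_notMem (by simp [hi]), hf.2.2]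

end Surj

section Labelling
variable {n k : ℕ}

/-- The function sending each element to the label of its block. -/
def labelMap (P : Finpartition (univ : Finset (Fin n))) (e : P.parts ≃ Fin k) (x : Fin n) :
    Fin k :=
  e ⟨P.part x, P.part_mem.2 (mem_univ x)⟩

theorem filter_labelMap_eq (P : Finpartition (univ : Finset (Fin n))) (e : P.parts ≃ Fin k)
    (j : Fin k) : ({x | labelMap P e x = j} : Finset (Fin n)) = (e.symm j).1 := by
  ext x
  rw [mem_filter, labelMap, ← Equiv.eq_symm_apply, Subtype.ext_iff,
    P.part_eq_iff_mem (e.symm j).2]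
  simp

theorem fiberCard_labelMap (P : Finpartition (univ : Finset (Fin n))) (e : P.parts ≃ Fin k)
    (j : Fin k) : fiberCard (labelMap P e) j = #(e.symm j).1 := by
  rw [fiberCard, filter_labelMap_eq]

theorem labelMap_surjective (P : Finpartition (univ : Finset (Fin n))) (e : P.parts ≃ Fin k) :
    Function.Surjective (labelMap P e) := by
  rw [surjective_iff_fiberCard_pos]
  intro j
  rw [fiberCard_labelMap]
  exact (P.nonempty_of_mem_parts (e.symm j).2).card_pos

theorem card_filter_fiberCard_labelMap (P : Finpartition (univ : Finset (Fin n)))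
    (e : P.parts ≃ Fin k) (i : ℕ) :
    #{j | fiberCard (labelMap P e) j = i} = blockCount P i := by
  simp only [fiberCard_labelMap, blockCount]
  refine card_bij (fun j _ => (e.symm j).1) ?_ ?_ ?_
  · intro j hj
    simpa using hj
  · intro j _ j' _ h
    simpa using Subtype.ext h
  · intro b hb
    rw [mem_filter] at hb
    exact ⟨e ⟨b, hb.1⟩, by simpa using hb.2, by simp⟩

theorem labelMap_eq_iff {P P' : Finpartition (univ : Finset (Fin n))} {e : P.parts ≃ Fin k}
    {e' : P'.parts ≃ Fin k} (h : labelMap P e = labelMap P' e') :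
    P = P' ∧ HEq e e' := by
  have hs (j : Fin k) : (e.symm j).1 = (e'.symm j).1 := by
    rw [← filter_labelMap_eq, ← filter_labelMap_eq, h]
  have hP : P = P' := by
    apply Finpartition.ext
    ext b
    constructor <;> intro hb
    · have := hs (e ⟨b, hb⟩)
      rw [Equiv.symm_apply_apply] at this
      exact (show b = _ from this) ▸ (e'.symm _).2
    · have := hs (e' ⟨b, hb⟩)
      rw [Equiv.symm_apply_apply] at this
      exact (show _ = b from this) ▸ (e.symm _).2
  subst hP
  refine ⟨rfl, heq_of_eq ?_⟩
  rw [← Equiv.symm_symm e, ← Equiv.symm_symm e']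
  congr 1
  ext j : 2
  exact hs j

theorem exists_labelMap_eq {f : Fin n → Fin k} (hf : Function.Surjective f) :
    ∃ (P : Finpartition (univ : Finset (Fin n))) (e : P.parts ≃ Fin k), labelMap P e = f := by
  classical
  let P : Finpartition (univ : Finset (Fin n)) := Finpartition.ofSetoid (Setoid.ker f)
  have hpart (x : Fin n) : P.part x = ({y | f y = f x} : Finset (Fin n)) := by
    ext y
    rw [Finpartition.mem_part_ofSetoid_iff_rel, Setoid.ker_def]
    simp [eq_comm]
  let g : Fin k → P.parts := fun j => ⟨({y | f y = j} : Finset (Fin n)), by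
    obtain ⟨x, rfl⟩ := hf j
    rw [← hpart]
    exact P.part_mem.2 (mem_univ x)⟩
  have hg : Function.Bijective g := by
    constructor
    · intro i j h
      obtain ⟨x, rfl⟩ := hf i
      have : x ∈ (g (f x)).1 := by simp [g]
      rw [h] at this
      simpa [g] using this
    · rintro ⟨b, hb⟩
      obtain ⟨x, hx⟩ := P.nonempty_of_mem_parts hb
      refine ⟨f x, Subtype.ext ?_⟩
      exact (hpart x).symm.trans (P.part_eq_of_mem hb hx)
  refine ⟨P, (Equiv.ofBijective g hg).symm, ?_⟩
  ext1 x
  rw [labelMap, Equiv.symm_apply_eq]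
  exact Subtype.ext (hpart x)

theorem card_surjective_and (Q : (ℕ → ℕ) → Prop) :
    Nat.card {f : Fin n → Fin k //
        Function.Surjective f ∧ Q fun i => #{j | fiberCard f j = i}} =
      Nat.card {P : Finpartition (univ : Finset (Fin n)) //
        #P.parts = k ∧ Q (blockCount P)} * k.factorial := by
  classical
  let Φ : (Σ P : {P : Finpartition (univ : Finset (Fin n)) // #P.parts = k ∧ Q (blockCount P)},
      P.1.parts ≃ Fin k) → {f : Fin n → Fin k //
        Function.Surjective f ∧ Q fun i => #{j | fiberCard f j = i}} := fun m =>
    ⟨labelMap m.1.1 m.2, labelMap_surjective _ _, by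
      simp only [card_filter_fiberCard_labelMap]
      exact m.1.2.2⟩
  have hΦ : Function.Bijective Φ := by
    constructor
    · rintro ⟨⟨P, hP⟩, e⟩ ⟨⟨P', hP'⟩, e'⟩ h
      obtain ⟨hPP, he⟩ := labelMap_eq_iff (Subtype.ext_iff.1 h)
      dsimp only at hPP
      subst hPP
      dsimp only at he
      rw [eq_of_heq he]
    · rintro ⟨f, hf, hQ⟩
      obtain ⟨P, e, rfl⟩ := exists_labelMap_eq hf
      simp only [card_filter_fiberCard_labelMap] at hQ
      exact ⟨⟨⟨P, by simpa using Fintype.card_congr e, hQ⟩, e⟩, rfl⟩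
  rw [← Nat.card_congr (Equiv.ofBijective Φ hΦ), Nat.card_sigma, sum_congr rfl
    (g := fun _ => k.factorial), sum_const, smul_eq_mul, card_univ, Nat.card_eq_fintype_card]
  rintro ⟨P, hP, -⟩ -
  have e : P.parts ≃ Fin k := Fintype.equivFinOfCardEq (by simpa using hP)
  rw [Nat.card_eq_fintype_card, Fintype.card_equiv e]
  simp [hP]

theorem partProb_eq_div (Q : (ℕ → ℕ) → Prop) :
    partProb n k (fun P => Q (blockCount P)) =
      (Nat.card {f : Fin n → Fin k //
        Function.Surjective f ∧ Q fun i => #{j | fiberCard f j = i}} : ℝ) /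
      (Nat.card {f : Fin n → Fin k // Function.Surjective f} : ℝ) := by
  have h := card_surjective_and (n := n) (k := k) fun _ => True
  simp only [and_true] at h
  rw [card_surjective_and, h, partProb]
  push_cast
  rw [mul_div_mul_right _ _ (by positivity)]

end Labelling

section Poisson
open scoped NNReal

/-- The mass `exp (-l) * l ^ z / z!` that the Poisson distribution gives to `z`. -/
noncomputable def poissonMass (l : ℝ≥0) (z : ℕ) : ℝ := Real.exp (-l) * l ^ z / z.factorial

theorem poissonMass_nonneg {l : ℝ≥0} {z : ℕ} : 0 ≤ poissonMass l z := by
  unfold poissonMass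
  positivity

theorem hasSum_poissonMass (l : ℝ≥0) : HasSum (poissonMass l) 1 :=
  ProbabilityTheory.hasSum_one_poissonMeasure l

theorem abs_prod_sub_one_le {a : ℕ → ℝ} {ε : ℝ} (hε : 0 ≤ ε) (ha0 : ∀ z, 0 ≤ a z)
    (ha2 : ∀ z, a z ≤ 2) (ha : ∀ z : ℕ, |a z - 1| ≤ ε * (z + 1)) (z : ℕ) :
    |∏ j ∈ range z, a j - 1| ≤ ε * 8 ^ z := by
  induction z with
  | zero => simpa using hε
  | succ z ih =>
    have h8 : (z : ℝ) + 1 ≤ 8 ^ z := by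
      have := one_add_mul_le_pow (show (-2 : ℝ) ≤ 7 by norm_num) z
      norm_num at this
      linarith [(Nat.cast_nonneg z : (0 : ℝ) ≤ z)]
    rw [prod_range_succ]
    calc |(∏ j ∈ range z, a j) * a z - 1|
        = |(∏ j ∈ range z, a j - 1) * a z + (a z - 1)| := by ring_nf
      _ ≤ |∏ j ∈ range z, a j - 1| * a z + |a z - 1| := by
          refine (abs_add_le _ _).trans ?_
          rw [abs_mul, abs_of_nonneg (ha0 z)]
      _ ≤ ε * 8 ^ z * 2 + ε * 8 ^ z := by
          gcongr
          · exact ha0 z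
          · exact ha2 z
          · exact (ha z).trans (by gcongr)
      _ ≤ ε * 8 ^ (z + 1) := by
          rw [pow_succ]
          nlinarith [mul_nonneg hε (pow_nonneg (show (0 : ℝ) ≤ 8 by norm_num) z)]

theorem hasSum_poissonMass_mul_pow (l c : ℝ≥0) :
    HasSum (fun z => poissonMass l z * (c : ℝ) ^ z) (Real.exp (((c : ℝ) - 1) * l)) := by
  have h := (hasSum_poissonMass (c * l)).mul_left (Real.exp (((c : ℝ) - 1) * l))
  rw [mul_one] at h
  refine h.congr_fun fun z => ?_
  simp only [poissonMass]
  rw [mul_div_assoc', ← mul_assoc, ← Real.exp_add]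
  push_cast
  ring_nf

/-- A sub-probability sequence satisfying the Poisson recursion up to small relative errors is
close to the Poisson distribution. -/
theorem abs_tsum_indicator_sub_poisson_le {l : ℝ≥0} {p a : ℕ → ℝ} {ε b : ℝ} (hε : 0 ≤ ε)
    (hb : 0 ≤ b) (hp : ∀ z, 0 ≤ p z) (hsum : HasSum p (1 - b))
    (hrec : ∀ z : ℕ, p (z + 1) * (z + 1) = p z * (l * a z)) (ha0 : ∀ z, 0 ≤ a z)
    (ha2 : ∀ z, a z ≤ 2) (ha : ∀ z : ℕ, |a z - 1| ≤ ε * (z + 1))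
    (hsmall : ε * Real.exp (7 * l) ≤ 1 / 2) (S : Set ℕ) :
    |∑' z, S.indicator p z - ∑' z, S.indicator (poissonMass l) z| ≤
      4 * (ε * Real.exp (7 * l)) + b := by
  set α := p 0 * Real.exp l with hα
  have hα0 : 0 ≤ α := mul_nonneg (hp 0) (Real.exp_nonneg _)
  have hform (z : ℕ) : p z = α * poissonMass l z * ∏ j ∈ range z, a j := by
    induction z with
    | zero => simp [poissonMass, hα, mul_assoc, ← Real.exp_add]
    | succ z ih =>
      have h1 : ((z : ℝ) + 1) ≠ 0 := by positivity
      have h2 : poissonMass l (z + 1) * (z + 1) = poissonMass l z * l := by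
        rw [poissonMass, poissonMass, Nat.factorial_succ]
        push_cast
        field_simp
        ring
      apply mul_right_cancel₀ h1
      rw [hrec, ih, prod_range_succ]
      linear_combination -(α * (∏ j ∈ range z, a j) * a z) * h2
  have hπ := hasSum_poissonMass l
  have h8 := hasSum_poissonMass_mul_pow l 8
  norm_num at h8
  have hdiff (z : ℕ) : |p z - α * poissonMass l z| ≤
      α * ε * (poissonMass l z * 8 ^ z) := by
    have h := abs_prod_sub_one_le hε ha0 ha2 ha z
    have hπ0 : 0 ≤ poissonMass l z := poissonMass_nonneg
    calc |p z - α * poissonMass l z|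
        = α * poissonMass l z * |∏ j ∈ range z, a j - 1| := by
          rw [hform z, ← mul_sub_one, abs_mul, abs_of_nonneg (mul_nonneg hα0 hπ0)]
      _ ≤ α * poissonMass l z * (ε * 8 ^ z) := by gcongr
      _ = _ := by ring
  have hset (S : Set ℕ) : |∑' z, S.indicator p z -
      α * ∑' z, S.indicator (poissonMass l) z| ≤ α * (ε * Real.exp (7 * l)) := by
    rw [← tsum_mul_left, ← (hsum.summable.indicator S).tsum_sub
      ((hπ.summable.indicator S).mul_left α)]
    have := tsum_of_norm_bounded (f := fun z => S.indicator p z -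
      α * S.indicator (poissonMass l) z) (h8.mul_left (α * ε)) ?_
    · rw [Real.norm_eq_abs] at this
      rwa [← mul_assoc]
    · intro z
      by_cases hz : z ∈ S
      · simpa [hz] using hdiff z
      · have : 0 ≤ poissonMass l z := poissonMass_nonneg
        simp only [hz, not_false_eq_true, Set.indicator_of_notMem, mul_zero, sub_zero, norm_zero]
        positivity
  have huniv := hset Set.univ
  rw [Set.indicator_univ, Set.indicator_univ, hsum.tsum_eq, hπ.tsum_eq, mul_one] at huniv
  have hα2 : α ≤ 2 := by
    have := (abs_le.1 huniv).1
    nlinarith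
  have hq0 : 0 ≤ ∑' z, S.indicator (poissonMass l) z :=
    tsum_nonneg fun z => Set.indicator_nonneg (fun _ _ => poissonMass_nonneg) z
  have hq1 : ∑' z, S.indicator (poissonMass l) z ≤ 1 := by
    rw [← hπ.tsum_eq]
    exact (hπ.summable.indicator S).tsum_le_tsum
      (fun z => Set.indicator_le_self' (fun _ _ => poissonMass_nonneg) z) hπ.summable
  have hS := hset S
  set P := ∑' z, S.indicator p z
  set q := ∑' z, S.indicator (poissonMass l) z
  have hδ : 0 ≤ ε * Real.exp (7 * l) := by positivity
  have hα1 : |α - 1| ≤ α * (ε * Real.exp (7 * l)) + b := by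
    rw [abs_le] at huniv ⊢
    constructor <;> linarith
  calc |P - q| = |(P - α * q) + (α - 1) * q| := by ring_nf
    _ ≤ |P - α * q| + |α - 1| * q := by
        refine (abs_add_le _ _).trans ?_
        rw [abs_mul, abs_of_nonneg hq0]
    _ ≤ |P - α * q| + |α - 1| * 1 := by gcongr
    _ ≤ 4 * (ε * Real.exp (7 * l)) + b := by nlinarith

/-- The relative errors in the recursion for the number of triple blocks. -/
theorem recursion_error_bounds {n k r z : ℕ} (hr0 : 0 < r) (hkr : k + r = n) (h4 : 4 * r ≤ n) :
    let a : ℝ := ((r - 2 * z : ℕ) : ℝ) * ((r - 2 * z - 1 : ℕ) : ℝ) * n /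
      ((r : ℝ) ^ 2 * ((k : ℝ) - r + z + 1))
    0 ≤ a ∧ a ≤ 2 ∧ |a - 1| ≤ (4 * r / n + 4 / r : ℝ) * (z + 1) := by
  intro a
  have hr : (0 : ℝ) < r := by exact_mod_cast hr0
  have hk : (k : ℝ) + r = n := by exact_mod_cast hkr
  have h4' : 4 * (r : ℝ) ≤ n := by exact_mod_cast h4
  have hz : (0 : ℝ) ≤ z := Nat.cast_nonneg z
  have hd : 0 < (k : ℝ) - r + z + 1 := by linarith
  have hn : (0 : ℝ) < n := by linarith
  have hp : ((r - 2 * z : ℕ) : ℝ) ≤ r := by exact_mod_cast Nat.sub_le _ _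
  have hp' : ((r - 2 * z - 1 : ℕ) : ℝ) ≤ r := by
    exact_mod_cast (Nat.sub_le _ _).trans (Nat.sub_le _ _)
  have ha0 : 0 ≤ a := by positivity
  have hle : a ≤ n / ((k : ℝ) - r + z + 1) := by
    calc a ≤ (r : ℝ) * r * n / ((r : ℝ) ^ 2 * ((k : ℝ) - r + z + 1)) := by
          simp only [a]; gcongr
      _ = _ := by field_simp
  have hub : a ≤ 1 + 4 * r / n := by
    refine hle.trans ?_
    rw [div_le_iff₀ hd]
    have : (1 + 4 * (r : ℝ) / n) * (k - r + z + 1) =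
        ((n + 4 * r) * (k - r + z + 1)) / n := by field_simp
    rw [this, le_div_iff₀ hn]
    nlinarith
  have hub2 : 4 * (r : ℝ) / n ≤ 1 := by rwa [div_le_one hn]
  have hlb : 1 - (4 * z + 2) / r ≤ a := by
    by_cases hzr : 2 * z + 1 ≤ r
    · have e1 : ((r - 2 * z : ℕ) : ℝ) = r - 2 * z := by
        rw [Nat.cast_sub (by omega)]; push_cast; ring
      have e2 : ((r - 2 * z - 1 : ℕ) : ℝ) = r - 2 * z - 1 := by
        rw [Nat.cast_sub (by omega), e1]; push_cast; ring
      have hzr' : 2 * (z : ℝ) + 1 ≤ r := by exact_mod_cast hzr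
      have hdn : (k : ℝ) - r + z + 1 ≤ n := by linarith
      calc 1 - (4 * z + 2) / (r : ℝ) = (r * (r - (4 * z + 2))) / (r : ℝ) ^ 2 := by field_simp
        _ ≤ ((r - 2 * z) * (r - 2 * z - 1)) / (r : ℝ) ^ 2 :=
            div_le_div_of_nonneg_right (by nlinarith) (by positivity)
        _ = ((r - 2 * z) * (r - 2 * z - 1)) * n / ((r : ℝ) ^ 2 * n) := by field_simp
        _ ≤ a := by
          simp only [a, e1, e2]
          have : 0 ≤ ((r : ℝ) - 2 * z) * (r - 2 * z - 1) :=
            mul_nonneg (by linarith) (by linarith)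
          gcongr
    · refine le_trans ?_ ha0
      rw [sub_nonpos, le_div_iff₀ hr]
      have : (r : ℝ) ≤ 2 * z := by exact_mod_cast (by omega : r ≤ 2 * z)
      linarith
  refine ⟨ha0, by linarith, ?_⟩
  have h1 : 0 ≤ 4 * (r : ℝ) / n := by positivity
  have h2 : (4 * z + 2) / (r : ℝ) ≤ 4 / r * (z + 1) := by
    rw [div_mul_eq_mul_div]; gcongr; linarith
  have h3 : 0 ≤ 4 / (r : ℝ) := by positivity
  rw [abs_le]
  constructor <;> nlinarith

end Poisson

section Comparison
open scoped NNReal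

/-- The block counts of a partition of an `n`-set into `k` blocks, `z` of them of size three and
none larger. -/
def tripleProfile (n k : ℕ) (z : ℕ) (i : ℕ) : ℤ :=
  if i = 1 then 2 * (k : ℤ) - n + z
  else if i = 2 then ((n - k : ℕ) : ℤ) - 2 * z
  else if i = 3 then (z : ℤ) else 0

variable {n k r : ℕ}

theorem profile_eq_of_mem {z : ℕ} (hkr : k + r = n) {f : Fin n → Fin k}
    (hf : f ∈ tripleSurjections (Fin n) (Fin k) z) :
    (fun i => (#{j | fiberCard f j = i} : ℤ)) = tripleProfile n k z := by
  obtain ⟨h2, h1⟩ := card_double_single_of_mem (r := r) (by simpa using hkr) hf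
  simp only [tripleSurjections, mem_filter, mem_surjections, surjective_iff_fiberCard_pos] at hf
  obtain ⟨hp, hle, h3⟩ := hf
  rw [Fintype.card_fin] at h1
  ext i
  unfold tripleProfile
  split_ifs with hi hi hi
  · subst hi; omega
  · subst hi; omega
  · subst hi; omega
  · rw [Nat.cast_eq_zero, card_eq_zero, filter_eq_empty_iff]
    intro j _
    have := hp j
    have := hle j
    omega

theorem card_surjections_pos (hk : 0 < k) (hkr : k + r = n) :
    0 < #(surjections (Fin n) (Fin k)) := by
  have : Nonempty (Fin k) := ⟨⟨0, hk⟩⟩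
  exact card_pos.2 ⟨_, mem_surjections.2
    (Function.invFun_surjective (Fin.castLE_injective (show k ≤ n by omega)))⟩

theorem card_filter_big_le (hkr : k + r = n) (hr0 : 0 < r) (h4 : 4 * r ≤ n) :
    (#{f ∈ surjections (Fin n) (Fin k) | ∃ j, 4 ≤ fiberCard f j} : ℝ) ≤
      4 / 3 * r ^ 3 / n ^ 2 * #(surjections (Fin n) (Fin k)) := by
  set T := #(surjections (Fin n) (Fin k))
  have hc : Fintype.card (Fin k) + r = Fintype.card (Fin n) := by simpa using hkr
  have e4 := sum_card_big_le (m := 3) hc (by norm_num)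
  have e3 := sum_card_big_le (m := 2) hc le_rfl
  have e2 : ∑ f ∈ surjections (Fin n) (Fin k), #{j | 2 ≤ fiberCard f j} ≤ T * r := by
    rw [← smul_eq_mul]
    refine sum_le_card_nsmul _ _ _ fun f hf => ?_
    have := card_add_card_big_le (mem_surjections.1 hf)
    omega
  have e1 : #{f ∈ surjections (Fin n) (Fin k) | ∃ j, 4 ≤ fiberCard f j} ≤
      ∑ f ∈ surjections (Fin n) (Fin k), #{j | 4 ≤ fiberCard f j} := by
    rw [card_filter]
    refine sum_le_sum fun f _ => ?_
    split_ifs with h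
    · obtain ⟨j, hj⟩ := h
      exact card_pos.2 ⟨j, by simpa using hj⟩
    · exact Nat.zero_le _
  norm_num only [Fintype.card_fin] at e4 e3
  set E2 := ∑ f ∈ surjections (Fin n) (Fin k), #{j | 2 ≤ fiberCard f j}
  set E3 := ∑ f ∈ surjections (Fin n) (Fin k), #{j | 3 ≤ fiberCard f j}
  set E4 := ∑ f ∈ surjections (Fin n) (Fin k), #{j | 4 ≤ fiberCard f j}
  have hn : (0 : ℝ) < n := by exact_mod_cast (by omega : 0 < n)
  have e3' : 3 * n * E3 ≤ 4 * r ^ 2 * T := by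
    calc 3 * n * E3 ≤ 3 * (2 * (k - r)) * E3 := by gcongr; omega
      _ = 2 * (3 * (k - r) * E3) := by ring
      _ ≤ 2 * (2 * r * E2) := by gcongr
      _ ≤ 2 * (2 * r * (T * r)) := by gcongr
      _ = _ := by ring
  have e4' : n * E4 ≤ r * E3 := by
    have : 4 * (n * E4) ≤ 4 * (r * E3) := by
      calc 4 * (n * E4) ≤ 4 * (2 * (k - r) * E4) := by gcongr; omega
        _ = 2 * (4 * (k - r) * E4) := by ring
        _ ≤ 2 * (2 * r * E3) := by gcongr
        _ = _ := by ring
    omega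
  have e3r : 3 * (n : ℝ) * E3 ≤ 4 * r ^ 2 * T := by exact_mod_cast e3'
  have e4r : (n : ℝ) * E4 ≤ r * E3 := by exact_mod_cast e4'
  refine (Nat.cast_le.2 e1).trans ?_
  have : 4 / 3 * (r : ℝ) ^ 3 / n ^ 2 * T = (4 / 3 * r ^ 3 * T) / n ^ 2 := by ring
  rw [this, le_div_iff₀ (by positivity)]
  have hr : (0 : ℝ) < r := by exact_mod_cast hr0
  nlinarith [mul_le_mul_of_nonneg_left e4r hn.le, mul_le_mul_of_nonneg_left e3r hr.le]

theorem card_profile_mem (hkr : k + r = n) (A : Set (ℕ → ℤ)) [DecidablePred (· ∈ A)] :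
    #{f ∈ surjections (Fin n) (Fin k) | (fun i => (#{j | fiberCard f j = i} : ℤ)) ∈ A} =
      #{f ∈ surjections (Fin n) (Fin k) | (fun i => (#{j | fiberCard f j = i} : ℤ)) ∈ A ∧
        ∃ j, 4 ≤ fiberCard f j} +
      ∑ z ∈ range (k + 1) with tripleProfile n k z ∈ A,
        #(tripleSurjections (Fin n) (Fin k) z) := by
  classical
  rw [← card_filter_add_card_filter_not (p := fun f => ∃ j, 4 ≤ fiberCard f j), filter_filter]
  congr 1
  rw [card_eq_sum_card_fiberwise (f := fun f => #{j | fiberCard f j = 3})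
    (t := {z ∈ range (k + 1) | tripleProfile n k z ∈ A})]
  · refine sum_congr rfl fun z hz => congrArg _ ?_
    ext f
    constructor
    · intro hf
      simp only [mem_filter, not_exists, not_le] at hf
      simp only [tripleSurjections, mem_filter]
      exact ⟨hf.1.1.1, fun j => Nat.le_of_lt_succ (hf.1.2 j), hf.2⟩
    · intro hf
      have hprof := profile_eq_of_mem hkr hf
      simp only [tripleSurjections, mem_filter] at hf hz
      simp only [mem_filter, not_exists, not_le, hprof]
      exact ⟨⟨⟨hf.1, hz.2⟩, fun j => Nat.lt_succ_of_le (hf.2.1 j)⟩, hf.2.2⟩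
  · intro f hf
    simp only [coe_filter, mem_filter, Set.mem_ofPred_eq, not_exists, not_le] at hf
    have hprof := profile_eq_of_mem (z := #{j | fiberCard f j = 3}) hkr (f := f) (by
      simp only [tripleSurjections, mem_filter]
      exact ⟨hf.1.1, fun j => Nat.le_of_lt_succ (hf.2 j), trivial⟩)
    simp only [coe_filter, mem_range, Set.mem_ofPred_eq]
    refine ⟨Nat.lt_succ_of_le ((card_le_univ _).trans_eq (Fintype.card_fin k)), ?_⟩
    rw [← hprof]
    exact hf.1.2

theorem abs_partProb_sub_poisson_le (hkr : k + r = n) (hr0 : 0 < r) (h4 : 4 * r ≤ n) {l : ℝ≥0}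
    (hl : (l : ℝ) = 2 / 3 * r ^ 2 / n)
    (hsmall : (4 * r / n + 4 / r : ℝ) * Real.exp (7 * l) ≤ 1 / 2) (A : Set (ℕ → ℤ)) :
    |partProb n k (fun P => (fun i => (blockCount P i : ℤ)) ∈ A) -
      ∑' z : ℕ, (tripleProfile n k ⁻¹' A).indicator (poissonMass l) z| ≤
      4 * ((4 * r / n + 4 / r : ℝ) * Real.exp (7 * l)) + 2 * (4 / 3 * r ^ 3 / n ^ 2) := by
  classical
  have hT := card_surjections_pos (by omega : 0 < k) hkr
  set T := #(surjections (Fin n) (Fin k)) with hTdef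
  have hT' : (0 : ℝ) < T := by exact_mod_cast hT
  have hr : (0 : ℝ) < r := by exact_mod_cast hr0
  have hn : (0 : ℝ) < n := by exact_mod_cast (by omega : 0 < n)
  have hk : (k : ℝ) + r = n := by exact_mod_cast hkr
  have h4' : 4 * (r : ℝ) ≤ n := by exact_mod_cast h4
  set B := #{f ∈ surjections (Fin n) (Fin k) | ∃ j, 4 ≤ fiberCard f j} with hB
  have hBle : (B : ℝ) / T ≤ 4 / 3 * r ^ 3 / n ^ 2 :=
    (div_le_iff₀ hT').2 (card_filter_big_le hkr hr0 h4)
  let p : ℕ → ℝ := fun z => #(tripleSurjections (Fin n) (Fin k) z) / T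
  have hzero (z : ℕ) (hz : z ∉ range (k + 1)) : p z = 0 := by
    simp only [p, div_eq_zero_iff, Nat.cast_eq_zero, card_eq_zero]
    left
    refine eq_empty_of_forall_notMem fun f hf => hz ?_
    simp only [tripleSurjections, mem_filter] at hf
    rw [mem_range, ← hf.2.2]
    exact Nat.lt_succ_of_le ((card_le_univ _).trans_eq (Fintype.card_fin k))
  have hind (A : Set (ℕ → ℤ)) : ∑' z, (tripleProfile n k ⁻¹' A).indicator p z =
      (∑ z ∈ range (k + 1) with tripleProfile n k z ∈ A,
        #(tripleSurjections (Fin n) (Fin k) z) : ℕ) / (T : ℝ) := by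
    rw [tsum_eq_sum (s := range (k + 1)) fun z hz => by simp [Set.indicator, hzero z hz],
      sum_filter, Nat.cast_sum, sum_div]
    refine sum_congr rfl fun z _ => ?_
    simp only [Set.indicator, Set.mem_preimage]
    split_ifs <;> simp [p]
  have hsum : HasSum p (1 - B / T) := by
    have h1 : HasSum p (∑ z ∈ range (k + 1), p z) := hasSum_sum_of_ne_finset_zero hzero
    have h2 := hind Set.univ
    rw [Set.preimage_univ, Set.indicator_univ] at h2
    have h3 := card_profile_mem hkr (Set.univ : Set (ℕ → ℤ))
    simp only [Set.mem_univ, true_and, filter_true, ← hTdef, ← hB] at h2 h3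
    rw [h1.summable.hasSum_iff, h2, eq_sub_iff_add_eq, ← add_div, add_comm]
    rw [div_eq_one_iff_eq hT'.ne']
    exact_mod_cast h3.symm
  have hrec (z : ℕ) : p (z + 1) * (z + 1) = p z * (l *
      (((r - 2 * z : ℕ) : ℝ) * ((r - 2 * z - 1 : ℕ) : ℝ) * n /
      ((r : ℝ) ^ 2 * ((k : ℝ) - r + z + 1)))) := by
    have h := card_tripleSurjections_succ (α := Fin n) (β := Fin k) (r := r) (by simpa using hkr)
      (by simp; omega) z
    rw [Fintype.card_fin] at h
    have h' := congrArg (Nat.cast (R := ℝ)) h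
    have hd : (k : ℝ) - r + z + 1 ≠ 0 := by
      have := (Nat.cast_nonneg z : (0 : ℝ) ≤ z)
      linarith
    push_cast [Nat.cast_sub (show r ≤ k by omega)] at h'
    simp only [p, hl]
    field_simp
    linear_combination h'
  have hmain := abs_tsum_indicator_sub_poisson_le (by positivity) (by positivity)
    (fun z => by positivity) hsum hrec (fun z => (recursion_error_bounds hr0 hkr h4).1)
    (fun z => (recursion_error_bounds hr0 hkr h4).2.1)
    (fun z => (recursion_error_bounds hr0 hkr h4).2.2) hsmall (tripleProfile n k ⁻¹' A)
  have hprob : partProb n k (fun P => (fun i => (blockCount P i : ℤ)) ∈ A) =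
      #{f ∈ surjections (Fin n) (Fin k) | (fun i => (#{j | fiberCard f j = i} : ℤ)) ∈ A ∧
        ∃ j, 4 ≤ fiberCard f j} / (T : ℝ) +
      ∑' z, (tripleProfile n k ⁻¹' A).indicator p z := by
    rw [hind, ← add_div, ← Nat.cast_add, ← card_profile_mem hkr A,
      partProb_eq_div fun D => (fun i => (D i : ℤ)) ∈ A, hTdef,
      Nat.subtype_card (p := Function.Surjective) (surjections (Fin n) (Fin k)) (by simp),
      Nat.subtype_card {f ∈ surjections (Fin n) (Fin k) |
        (fun i => (#{j | fiberCard f j = i} : ℤ)) ∈ A} (by simp)]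
  have hBA : (#{f ∈ surjections (Fin n) (Fin k) | (fun i => (#{j | fiberCard f j = i} : ℤ)) ∈ A ∧
        ∃ j, 4 ≤ fiberCard f j} / (T : ℝ)) ≤ B / T := by
    refine div_le_div_of_nonneg_right (Nat.cast_le.2 (card_le_card ?_)) hT'.le
    exact monotone_filter_right _ fun f _ h => h.2
  rw [hprob, add_sub_assoc]
  refine (abs_add_le _ _).trans ?_
  rw [abs_of_nonneg (by positivity)]
  linarith

end Comparison

/-- let `t > 0` and `k(n)` be an increasing sequence of positive integers with
`(n − k(n))/√n → t`. Let `D = (D_1, D_2, …)` be the block-size counts of a uniformly random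
set partition of `{1,…,n}` into exactly `k(n)` blocks and let `Z₂` be Poisson with mean
`(2/3)(n−k)²/n`. Then there are `C > 0` and `N` such that for all `n ≥ N` the total variation
distance between `D` and `(2k − n + Z₂, (n−k) − 2Z₂, Z₂, 0, 0, …)` is at most
`C·exp((4/3)(n−k)²/n)·(n−k)³/n²`. -/
theorem set_partition_block_structure (t : ℝ) (ht : 0 < t) (k : ℕ → ℕ)
    (hmono : Monotone k) (hpos : ∀ n, 0 < k n)
    (hlim : Tendsto (fun n : ℕ => ((n - k n : ℕ) : ℝ) / Real.sqrt n) atTop (nhds t)) :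
    ∃ C > (0 : ℝ), ∃ N : ℕ, ∀ n ≥ N,
      (⨆ A : Set (ℕ → ℤ),
        |partProb n (k n) (fun P => (fun i => (blockCount P i : ℤ)) ∈ A) -
          ∑' z : ℕ,
            A.indicator
              (fun _ => ProbabilityTheory.poissonPMFReal
                (Real.toNNReal ((2/3) * ((n - k n : ℕ) : ℝ) ^ 2 / n)) z)
              (fun i => if i = 1 then 2 * (k n : ℤ) - n + z
                else if i = 2 then ((n - k n : ℕ) : ℤ) - 2 * z
                else if i = 3 then (z : ℤ) else 0)|)
        ≤ C * Real.exp ((4/3) * ((n - k n : ℕ) : ℝ) ^ 2 / n) *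
            ((n - k n : ℕ) : ℝ) ^ 3 / (n : ℝ) ^ 2 := by
  have hsq : Tendsto (fun n : ℕ => (Real.sqrt n)⁻¹) atTop (nhds 0) :=
    (Real.tendsto_sqrt_atTop.comp tendsto_natCast_atTop_atTop).inv_tendsto_atTop
  have hsmall : Tendsto (fun n : ℕ =>
      (4 * (((n - k n : ℕ) : ℝ) / Real.sqrt n) + 4 / (((n - k n : ℕ) : ℝ) / Real.sqrt n)) *
        Real.exp (7 * (2 / 3 * (((n - k n : ℕ) : ℝ) / Real.sqrt n) ^ 2)) * (Real.sqrt n)⁻¹)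
      atTop (nhds 0) := by
    have h := ((((hlim.const_mul 4).add (hlim.inv₀ ht.ne' |>.const_mul 4)).mul
      (Real.continuous_exp.tendsto _ |>.comp (((hlim.pow 2).const_mul (2 / 3)).const_mul 7))).mul
      hsq)
    rw [mul_zero] at h
    exact h
  have hev := ((hlim.eventually (lt_mem_nhds (half_lt_self ht))).and
    ((hlim.eventually (gt_mem_nhds (lt_add_one t))).and
      ((hsmall.eventually (gt_mem_nhds (show (0 : ℝ) < 1 / 2 by norm_num))).and
        (eventually_gt_atTop 0))))
  obtain ⟨N, hN⟩ := eventually_atTop.1 hev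
  refine ⟨4 * ((16 / t ^ 2 + 64 / t ^ 4) * Real.exp (7 * (2 / 3 * (t + 1) ^ 2))) + 8 / 3,
    by positivity, N, fun n hn => ?_⟩
  obtain ⟨hs1, hs2, hε, hn0⟩ := hN n hn
  set r := n - k n with hr
  set s := (r : ℝ) / Real.sqrt n with hs
  have hnR : (0 : ℝ) < n := by exact_mod_cast hn0
  have hq : 0 < Real.sqrt n := Real.sqrt_pos.2 hnR
  have hqq : Real.sqrt n ^ 2 = n := Real.sq_sqrt hnR.le
  have hs0 : 0 < s := by linarith
  have hrs : (r : ℝ) = s * Real.sqrt n := by rw [hs]; field_simp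
  have hrR : (0 : ℝ) < r := by rw [hrs]; positivity
  have hr0 : 0 < r := by exact_mod_cast hrR
  have hsl : (2 / 3 : ℝ) * r ^ 2 / n = 2 / 3 * s ^ 2 := by
    rw [hrs, mul_pow, hqq]
    field_simp
  have hl : ((Real.toNNReal ((2/3) * (r : ℝ) ^ 2 / n) : NNReal) : ℝ) = 2 / 3 * r ^ 2 / n :=
    Real.coe_toNNReal _ (by positivity)
  have hεeq : (4 * r / n + 4 / r : ℝ) = (4 * s + 4 / s) * (Real.sqrt n)⁻¹ := by
    rw [hrs, ← hqq]
    simp only [Real.sqrt_sq hq.le]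
    field_simp
  have hε' : (4 * r / n + 4 / r : ℝ) *
      Real.exp (7 * (Real.toNNReal ((2/3) * (r : ℝ) ^ 2 / n) : NNReal)) ≤ 1 / 2 := by
    rw [hl, hsl, hεeq]
    linarith
  have h4 : 4 * r ≤ n := by
    have h1 : (4 * r / n + 4 / r : ℝ) ≤ 1 / 2 := by
      refine le_trans (le_mul_of_one_le_right (by positivity) (Real.one_le_exp ?_)) hε'
      positivity
    have h2 : (0 : ℝ) < 4 / r := by positivity
    have h3 : (4 * r / n : ℝ) ≤ 1 := by linarith
    rw [div_le_one hnR] at h3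
    exact_mod_cast h3
  have hD : (0 : ℝ) ≤ (r : ℝ) ^ 3 / n ^ 2 := by positivity
  have hεle : (4 * r / n + 4 / r : ℝ) ≤ (16 / t ^ 2 + 64 / t ^ 4) * ((r : ℝ) ^ 3 / n ^ 2) := by
    have h1 : (4 * r / n + 4 / r : ℝ) =
        (4 / s ^ 2 + 4 / s ^ 4) * ((r : ℝ) ^ 3 / n ^ 2) := by
      rw [hrs, ← hqq]
      simp only [Real.sqrt_sq hq.le]
      field_simp
    have h2 : 4 / s ^ 2 ≤ 16 / t ^ 2 := by
      calc 4 / s ^ 2 ≤ 4 / (t / 2) ^ 2 := by gcongr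
        _ = _ := by ring
    have h3 : 4 / s ^ 4 ≤ 64 / t ^ 4 := by
      calc 4 / s ^ 4 ≤ 4 / (t / 2) ^ 4 := by gcongr
        _ = _ := by ring
    rw [h1]
    gcongr
  refine ciSup_le fun A => ?_
  refine (abs_partProb_sub_poisson_le (r := r) (by omega) hr0 h4 hl hε' A).trans ?_
  rw [hl, hsl]
  have hexp : Real.exp (7 * (2 / 3 * s ^ 2)) ≤ Real.exp (7 * (2 / 3 * (t + 1) ^ 2)) := by
    gcongr
  have hexp1 : 1 ≤ Real.exp ((4/3) * (r : ℝ) ^ 2 / n) := Real.one_le_exp (by positivity)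
  calc 4 * ((4 * r / n + 4 / r : ℝ) * Real.exp (7 * (2 / 3 * s ^ 2))) +
        2 * (4 / 3 * r ^ 3 / n ^ 2)
      ≤ 4 * ((16 / t ^ 2 + 64 / t ^ 4) * ((r : ℝ) ^ 3 / n ^ 2) *
          Real.exp (7 * (2 / 3 * (t + 1) ^ 2))) + 2 * (4 / 3 * r ^ 3 / n ^ 2) := by gcongr
    _ = (4 * ((16 / t ^ 2 + 64 / t ^ 4) * Real.exp (7 * (2 / 3 * (t + 1) ^ 2))) + 8 / 3) * 1 *
          ((r : ℝ) ^ 3 / n ^ 2) := by ring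
    _ ≤ (4 * ((16 / t ^ 2 + 64 / t ^ 4) * Real.exp (7 * (2 / 3 * (t + 1) ^ 2))) + 8 / 3) *
          Real.exp ((4/3) * (r : ℝ) ^ 2 / n) * ((r : ℝ) ^ 3 / n ^ 2) := by gcongr
    _ = _ := by ring
end
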